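/- arXiv:2605.24360 — 4 statements merged into one kernel-verified Lean document; each statement's English description precedes it below -/
import Mathlib

section
/- Let a1, a2 ∈ H_A and b1, b2 ∈ H_B be unit vectors and set ψ1 = a1 ⊗ b1 and ψ2 = a2 ⊗ b2, assumed linearly independent. Then the following are equivalent: (i) there exist real numbers n1, n2 such that, for M = n1·|ψ1⟩⟨ψ1| + n2·|ψ2⟩⟨ψ2|, one has sup { Tr(σ M) : σ a separable density operator } < λmax(M); (ii) 0 < |⟨a1, a2⟩| < 1 and 0 < |⟨b1, b2⟩| < 1. -/
open scoped ComplexInnerProductSpace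
noncomputable section

/-- `HSp n` models a complex inner product space of dimension `n`. -/
abbrev HSp (n : ℕ) := EuclideanSpace ℂ (Fin n)

/-- `HT m n` models the tensor product `HSp m ⊗ HSp n`, with its induced inner product. -/
abbrev HT (m n : ℕ) := EuclideanSpace ℂ (Fin m × Fin n)

/-- The product (tensor) vector `a ⊗ b`. -/
def tmul {m n : ℕ} (a : HSp m) (b : HSp n) : HT m n :=
  (WithLp.equiv 2 _).symm fun p => a p.1 * b p.2

/-- `ψ` is a product vector. -/
def IsProd {m n : ℕ} (ψ : HT m n) : Prop := ∃ a b, ψ = tmul a b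

/-- The rank-one operator `|ψ⟩⟨ψ| : φ ↦ ⟨ψ, φ⟩ • ψ`; for a unit vector `ψ` this is the
orthogonal projection onto the span of `ψ`. -/
def rankOne {H : Type*} [NormedAddCommGroup H] [InnerProductSpace ℂ H] (ψ : H) :
    H →ₗ[ℂ] H := ((innerSL ℂ ψ).toLinearMap).smulRight ψ

/-- A density operator: positive semidefinite (self-adjoint) with trace one. -/
def IsDensity {H : Type*} [NormedAddCommGroup H] [InnerProductSpace ℂ H]
    [FiniteDimensional ℂ H] (ρ : H →ₗ[ℂ] H) : Prop :=
  LinearMap.IsSymmetric ρ ∧ (∀ x, 0 ≤ (⟪x, ρ x⟫).re) ∧ LinearMap.trace ℂ H ρ = 1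

/-- A separable density operator: a member of the convex hull of the set of rank-one
orthogonal projections onto unit product vectors. -/
def IsSepDensity {m n : ℕ} (σ : HT m n →ₗ[ℂ] HT m n) : Prop :=
  σ ∈ convexHull ℝ
    {P | ∃ (a : HSp m) (b : HSp n), ‖a‖ = 1 ∧ ‖b‖ = 1 ∧ P = rankOne (tmul a b)}

/-- The largest (real) eigenvalue `λmax` of an operator. -/
def lamMax {H : Type*} [NormedAddCommGroup H] [InnerProductSpace ℂ H]
    [FiniteDimensional ℂ H] (M : H →ₗ[ℂ] H) : ℝ :=
  sSup {t : ℝ | Module.End.HasEigenvalue M (t : ℂ)}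

/-- `sup { Tr(σ M) : σ a separable density operator }`. -/
def sepSup {m n : ℕ} (M : HT m n →ₗ[ℂ] HT m n) : ℝ :=
  sSup {t : ℝ | ∃ σ, IsSepDensity σ ∧ t = (LinearMap.trace ℂ _ (σ ∘ₗ M)).re}


lemma inner_tmul {m n : ℕ} (a c : HSp m) (b d : HSp n) :
    ⟪tmul a b, tmul c d⟫ = ⟪a, c⟫ * ⟪b, d⟫ := by
  simp only [tmul, PiLp.inner_apply, WithLp.equiv_symm_apply, Fintype.sum_prod_type,
    Finset.sum_mul_sum, RCLike.inner_apply, map_mul]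
  refine Finset.sum_congr rfl fun i _ => Finset.sum_congr rfl fun j _ => ?_
  ring

lemma norm_tmul_one {m n : ℕ} (a : HSp m) (b : HSp n) (ha : ‖a‖ = 1) (hb : ‖b‖ = 1) :
    ‖tmul a b‖ = 1 := by
  have h := inner_tmul a a b b
  rw [inner_self_eq_norm_sq_to_K, inner_self_eq_norm_sq_to_K, inner_self_eq_norm_sq_to_K,
    ha, hb] at h
  have h2 : ‖tmul a b‖ ^ 2 = 1 := by
    have : ((‖tmul a b‖ ^ 2 : ℝ) : ℂ) = ((1 : ℝ) : ℂ) := by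
      push_cast; simpa using h
    exact_mod_cast this
  have := norm_nonneg (tmul a b)
  nlinarith

lemma tmul_smul_right {m n : ℕ} (c : ℂ) (a : HSp m) (b : HSp n) :
    tmul a (c • b) = c • tmul a b := by
  ext p; simp [tmul]; ring

lemma tmul_smul_left {m n : ℕ} (c : ℂ) (a : HSp m) (b : HSp n) :
    tmul (c • a) b = c • tmul a b := by
  ext p; simp [tmul]; ring

lemma tmul_add_right {m n : ℕ} (a : HSp m) (b c : HSp n) :
    tmul a (b + c) = tmul a b + tmul a c := by
  ext p; simp [tmul]; ring

lemma tmul_add_left {m n : ℕ} (a c : HSp m) (b : HSp n) :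
    tmul (a + c) b = tmul a b + tmul c b := by
  ext p; simp [tmul]; ring

lemma M_apply {m n : ℕ} (n1 n2 : ℝ) (p q x : HT m n) :
    (n1 • rankOne p + n2 • rankOne q) x =
      ((n1 : ℂ) * ⟪p, x⟫) • p + ((n2 : ℂ) * ⟪q, x⟫) • q := by
  ext i
  simp [rankOne]; ring

lemma trace_rankOne_comp {m n : ℕ} (p : HT m n) (M : HT m n →ₗ[ℂ] HT m n) :
    LinearMap.trace ℂ _ (rankOne p ∘ₗ M) = ⟪p, M p⟫ := by
  have : rankOne p ∘ₗ M = ((innerSL ℂ p).toLinearMap ∘ₗ M).smulRight p := by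
    ext x; simp [rankOne]
  rw [this, LinearMap.trace_smulRight]
  simp

def sepSet {m n : ℕ} (M : HT m n →ₗ[ℂ] HT m n) : Set ℝ :=
  {t : ℝ | ∃ σ, IsSepDensity σ ∧ t = (LinearMap.trace ℂ _ (σ ∘ₗ M)).re}

lemma mem_sepSet {m n : ℕ} (M : HT m n →ₗ[ℂ] HT m n) (a : HSp m) (b : HSp n)
    (ha : ‖a‖ = 1) (hb : ‖b‖ = 1) : (⟪tmul a b, M (tmul a b)⟫).re ∈ sepSet M :=
  ⟨rankOne (tmul a b), subset_convexHull ℝ _ ⟨a, b, ha, hb, rfl⟩, by rw [trace_rankOne_comp]⟩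

lemma sepSet_le {m n : ℕ} (M : HT m n →ₗ[ℂ] HT m n) (K : ℝ)
    (h : ∀ (a : HSp m) (b : HSp n), ‖a‖ = 1 → ‖b‖ = 1 → (⟪tmul a b, M (tmul a b)⟫).re ≤ K) :
    ∀ t ∈ sepSet M, t ≤ K := by
  rintro t ⟨σ, hσ, rfl⟩
  have hc : Convex ℝ {σ : HT m n →ₗ[ℂ] HT m n | (LinearMap.trace ℂ _ (σ ∘ₗ M)).re ≤ K} := by
    intro x hx y hy s u hs hu hsu
    simp only [Set.mem_ofPred_eq] at *
    have e : (s • x + u • y) ∘ₗ M = (s : ℂ) • (x ∘ₗ M) + (u : ℂ) • (y ∘ₗ M) := by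
      ext v i; simp
    rw [e]
    simp only [map_add, map_smul, smul_eq_mul, Complex.add_re, Complex.re_ofReal_mul]
    calc _ ≤ s * K + u * K := by gcongr
      _ = K := by rw [← add_mul, hsu, one_mul]
  refine convexHull_min ?_ hc hσ
  rintro _ ⟨a, b, ha, hb, rfl⟩
  simpa [trace_rankOne_comp] using h a b ha hb

lemma sepSet_bdd {m n : ℕ} (M : HT m n →ₗ[ℂ] HT m n) : BddAbove (sepSet M) := by
  refine ⟨‖LinearMap.toContinuousLinearMap M‖, sepSet_le M _ fun a b ha hb => ?_⟩
  have h1 := norm_tmul_one a b ha hb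
  have h2 := (LinearMap.toContinuousLinearMap M).le_opNorm (tmul a b)
  have h3 := norm_inner_le_norm (𝕜 := ℂ) (tmul a b) (M (tmul a b))
  have h4 := Complex.re_le_norm ⟪tmul a b, M (tmul a b)⟫
  rw [h1] at h2 h3
  simp at h2 h3
  linarith

lemma exists_orth {n : ℕ} (hn : 2 ≤ n) (b : HSp n) : ∃ v : HSp n, ‖v‖ = 1 ∧ ⟪b, v⟫ = 0 := by
  have h : ∃ v : HSp n, v ≠ 0 ∧ ⟪b, v⟫ = 0 := by
    have hk : LinearMap.ker (innerSL ℂ b).toLinearMap ≠ ⊥ :=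
      LinearMap.ker_ne_bot_of_finrank_lt (by simp; omega)
    obtain ⟨v, hv, hv0⟩ := Submodule.exists_mem_ne_zero_of_ne_bot hk
    exact ⟨v, hv0, by simpa using hv⟩
  obtain ⟨v, hv, h⟩ := h
  refine ⟨((‖v‖⁻¹ : ℝ) : ℂ) • v, ?_, by simp [h]⟩
  have : ‖v‖ ≠ 0 := by simpa using hv
  rw [norm_smul]; simp [this]

lemma eig_mem {m n : ℕ} (M : HT m n →ₗ[ℂ] HT m n) (t : ℝ) (a : HSp m) (b : HSp n)
    (ha : ‖a‖ = 1) (hne : tmul a b ≠ 0) (h : M (tmul a b) = (t : ℂ) • tmul a b) :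
    t ∈ sepSet M := by
  have hb : b ≠ 0 := by
    rintro rfl; apply hne; ext p; simp [tmul]
  have hb' : ‖b‖ ≠ 0 := by simpa using hb
  have hu : ‖((‖b‖⁻¹ : ℝ) : ℂ) • b‖ = 1 := by rw [norm_smul]; simp [hb']
  have := mem_sepSet M a _ ha hu
  have h1 := norm_tmul_one a _ ha hu
  have h2 : M (tmul a (((‖b‖⁻¹ : ℝ) : ℂ) • b)) = (t : ℂ) • tmul a (((‖b‖⁻¹ : ℝ) : ℂ) • b) := by
    rw [tmul_smul_right, map_smul, h, smul_comm]
  rw [h2, inner_smul_right, inner_self_eq_norm_sq_to_K, h1] at this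
  simpa using this

lemma eig_mem' {m n : ℕ} (M : HT m n →ₗ[ℂ] HT m n) (t : ℝ) (a : HSp m) (b : HSp n)
    (hb : ‖b‖ = 1) (hne : tmul a b ≠ 0) (h : M (tmul a b) = (t : ℂ) • tmul a b) :
    t ∈ sepSet M := by
  have ha : a ≠ 0 := by
    rintro rfl; apply hne; ext p; simp [tmul]
  have ha' : ‖a‖ ≠ 0 := by simpa using ha
  have hu : ‖((‖a‖⁻¹ : ℝ) : ℂ) • a‖ = 1 := by rw [norm_smul]; simp [ha']
  have := mem_sepSet M _ b hu hb
  have h1 := norm_tmul_one _ b hu hb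
  have h2 : M (tmul (((‖a‖⁻¹ : ℝ) : ℂ) • a) b) = (t : ℂ) • tmul (((‖a‖⁻¹ : ℝ) : ℂ) • a) b := by
    rw [tmul_smul_left, map_smul, h, smul_comm]
  rw [h2, inner_smul_right, inner_self_eq_norm_sq_to_K, h1] at this
  simpa using this

lemma parallel {n : ℕ} (a b : HSp n) (ha : ‖a‖ = 1) (hb : ‖b‖ = 1) (h : ¬ ‖⟪a, b⟫‖ < 1) :
    ∃ k : ℂ, b = k • a := by
  have h1 : ‖⟪a, b⟫‖ = ‖a‖ * ‖b‖ :=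
    le_antisymm (norm_inner_le_norm _ _) (by rw [ha, hb]; linarith)
  have ha0 : a ≠ 0 := by rintro rfl; simp at ha
  have hb0 : b ≠ 0 := by rintro rfl; simp at hb
  obtain ⟨r, -, hr⟩ := (norm_inner_eq_norm_iff ha0 hb0).1 h1
  exact ⟨r, hr⟩

lemma forward {dA dB : ℕ} (hdA : 2 ≤ dA) (hdB : 2 ≤ dB)
    (a1 a2 : HSp dA) (b1 b2 : HSp dB)
    (ha1 : ‖a1‖ = 1) (ha2 : ‖a2‖ = 1) (hb1 : ‖b1‖ = 1) (hb2 : ‖b2‖ = 1) (n1 n2 : ℝ)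
    (h : ¬ (0 < ‖⟪a1, a2⟫‖ ∧ ‖⟪a1, a2⟫‖ < 1 ∧ 0 < ‖⟪b1, b2⟫‖ ∧ ‖⟪b1, b2⟫‖ < 1)) :
    lamMax (n1 • rankOne (tmul a1 b1) + n2 • rankOne (tmul a2 b2)) ≤
    sepSup (n1 • rankOne (tmul a1 b1) + n2 • rankOne (tmul a2 b2)) := by
  have hM := M_apply n1 n2 (tmul a1 b1) (tmul a2 b2)
  set M := n1 • rankOne (tmul a1 b1) + n2 • rankOne (tmul a2 b2) with hMdef
  have h0 : (0 : ℝ) ∈ sepSet M := by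
    obtain ⟨a, ha, ha'⟩ := exists_orth hdA a1
    obtain ⟨b, hb, hb'⟩ := exists_orth hdB b2
    have := mem_sepSet M a b ha hb
    rw [hM] at this
    simpa [inner_tmul, ha', hb'] using this
  have hψ1 := norm_tmul_one a1 b1 ha1 hb1
  have hψ2 := norm_tmul_one a2 b2 ha2 hb2
  have hs1 : ⟪tmul a1 b1, tmul a1 b1⟫ = 1 := by rw [inner_self_eq_norm_sq_to_K, hψ1]; simp
  have hs2 : ⟪tmul a2 b2, tmul a2 b2⟫ = 1 := by rw [inner_self_eq_norm_sq_to_K, hψ2]; simp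
  have hn1 : tmul a1 b1 ≠ 0 := by intro h; simp [h] at hψ1
  have hn2 : tmul a2 b2 ≠ 0 := by intro h; simp [h] at hψ2
  have hle : ∀ t ∈ sepSet M, t ≤ sepSup M := fun t ht => le_csSup (sepSet_bdd M) ht
  refine Real.sSup_le (fun t ht => ?_) (hle 0 h0)
  by_cases ht0 : t = 0
  · rw [ht0]; exact hle 0 h0
  apply hle
  have htc : (t : ℂ) ≠ 0 := by exact_mod_cast ht0
  obtain ⟨v, hv⟩ := Module.End.HasEigenvalue.exists_hasEigenvector ht
  have hv0 := hv.2
  have hv1 := hv.apply_eq_smul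
  have hv2 : v = (t : ℂ)⁻¹ • M v := by rw [hv1, smul_smul, inv_mul_cancel₀ htc, one_smul]
  by_cases hort : ⟪tmul a1 b1, tmul a2 b2⟫ = 0
  · have hort' : ⟪tmul a2 b2, tmul a1 b1⟫ = 0 := by rw [← inner_conj_symm, hort]; simp
    have e1 : (n1 : ℂ) * ⟪tmul a1 b1, v⟫ = t * ⟪tmul a1 b1, v⟫ := by
      rw [← inner_smul_right _ v (t : ℂ), ← hv1, hM, inner_add_right, inner_smul_right, inner_smul_right,
        hort, hs1]; ring
    have e2 : (n2 : ℂ) * ⟪tmul a2 b2, v⟫ = t * ⟪tmul a2 b2, v⟫ := by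
      rw [← inner_smul_right _ v (t : ℂ), ← hv1, hM, inner_add_right, inner_smul_right, inner_smul_right,
        hort', hs2]; ring
    by_cases z1 : ⟪tmul a1 b1, v⟫ = 0
    · by_cases z2 : ⟪tmul a2 b2, v⟫ = 0
      · exfalso; apply hv0; rw [hv2, hM, z1, z2]; simp
      · have := mul_right_cancel₀ z2 e2
        refine eig_mem M t a2 b2 ha2 hn2 ?_
        rw [hM, hort, hs2, ← this]; simp
    · have := mul_right_cancel₀ z1 e1
      refine eig_mem M t a1 b1 ha1 hn1 ?_
      rw [hM, hort', hs1, ← this]; simp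
  · rw [inner_tmul, mul_eq_zero, not_or] at hort
    have h' : ¬ ‖⟪a1, a2⟫‖ < 1 ∨ ¬ ‖⟪b1, b2⟫‖ < 1 := by
      by_contra hc
      push Not at hc
      exact h ⟨norm_pos_iff.2 hort.1, hc.1, norm_pos_iff.2 hort.2, hc.2⟩
    rcases h' with h' | h'
    · obtain ⟨k, hk⟩ := parallel a1 a2 ha1 ha2 h'
      have : ∃ w, v = tmul a1 w := by
        rw [hv2, hM]
        generalize (n1 : ℂ) * ⟪tmul a1 b1, v⟫ = c1
        generalize (n2 : ℂ) * ⟪tmul a2 b2, v⟫ = c2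
        rw [hk]
        refine ⟨(t : ℂ)⁻¹ • (c1 • b1 + c2 • k • b2), ?_⟩
        simp only [tmul_smul_left, tmul_smul_right, tmul_add_right]
      obtain ⟨w, rfl⟩ := this
      exact eig_mem M t _ _ ha1 hv0 hv1
    · obtain ⟨k, hk⟩ := parallel b1 b2 hb1 hb2 h'
      have : ∃ w, v = tmul w b1 := by
        rw [hv2, hM]
        generalize (n1 : ℂ) * ⟪tmul a1 b1, v⟫ = c1
        generalize (n2 : ℂ) * ⟪tmul a2 b2, v⟫ = c2
        rw [hk]
        refine ⟨(t : ℂ)⁻¹ • (c1 • a1 + c2 • k • a2), ?_⟩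
        simp only [tmul_smul_left, tmul_smul_right, tmul_add_left]
      obtain ⟨w, rfl⟩ := this
      exact eig_mem' M t _ _ hb1 hv0 hv1

/-- contraction of the second tensor factor -/
lemma contract {m n : ℕ} (a1 a2 a : HSp m) (b1 b2 b v : HSp n) (w1 w2 : ℂ)
    (h : tmul a b = w1 • tmul a1 b1 + w2 • tmul a2 b2) :
    ⟪v, b⟫ • a = (w1 * ⟪v, b1⟫) • a1 + (w2 * ⟪v, b2⟫) • a2 := by
  ext i
  have hj : ∀ j, a i * b j = w1 * (a1 i * b1 j) + w2 * (a2 i * b2 j) := by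
    intro j
    have := congrArg (fun x : HT m n => x (i, j)) h
    simpa [tmul] using this
  simp only [PiLp.inner_apply, RCLike.inner_apply, PiLp.smul_apply, PiLp.add_apply, smul_eq_mul,
    Finset.sum_mul, Finset.mul_sum]
  rw [← Finset.sum_add_distrib]
  refine Finset.sum_congr rfl fun j _ => ?_
  linear_combination (starRingEnd ℂ) (v j) * hj j

lemma li_pair {n : ℕ} (a1 a2 : HSp n) (ha1 : ‖a1‖ = 1) (ha2 : ‖a2‖ = 1)
    (h : ‖⟪a1, a2⟫‖ < 1) (c d : ℂ) (hcd : c • a1 + d • a2 = 0) : c = 0 ∧ d = 0 := by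
  have hd : d = 0 := by
    by_contra hd
    have e : a2 = (-(d⁻¹ * c)) • a1 := by
      have : d⁻¹ • (c • a1 + d • a2) = 0 := by rw [hcd, smul_zero]
      rw [smul_add, smul_smul, smul_smul, inv_mul_cancel₀ hd, one_smul] at this
      rw [neg_smul, eq_neg_iff_add_eq_zero, add_comm, this]
    rw [e, inner_smul_right, inner_self_eq_norm_sq_to_K, ha1] at h
    rw [e, norm_smul, ha1] at ha2
    simp only [RCLike.ofReal_one, one_pow, mul_one] at h ha2
    simp at h ha2
    linarith
  subst hd
  refine ⟨?_, rfl⟩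
  have : a1 ≠ 0 := by rintro rfl; simp at ha1
  simpa [this] using hcd

lemma not_prod {m n : ℕ} (a1 a2 a : HSp m) (b1 b2 b : HSp n) (w1 w2 : ℂ)
    (ha1 : ‖a1‖ = 1) (ha2 : ‖a2‖ = 1) (hb1 : ‖b1‖ = 1) (hb2 : ‖b2‖ = 1) (hb : ‖b‖ = 1)
    (hA : ‖⟪a1, a2⟫‖ < 1) (hB : ‖⟪b1, b2⟫‖ < 1) (hw1 : w1 ≠ 0) (hw2 : w2 ≠ 0)
    (h : tmul a b = w1 • tmul a1 b1 + w2 • tmul a2 b2) : False := by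
  have key : ∀ v : HSp n, ⟪v, b⟫ = 0 → ⟪v, b1⟫ = 0 ∧ ⟪v, b2⟫ = 0 := by
    intro v hv
    have := contract a1 a2 a b1 b2 b v w1 w2 h
    rw [hv, zero_smul] at this
    have := li_pair a1 a2 ha1 ha2 hA _ _ this.symm
    simpa [hw1, hw2] using this
  have hbb : ⟪b, b⟫ = 1 := by rw [inner_self_eq_norm_sq_to_K, hb]; simp
  have orth : ∀ x : HSp n, ⟪x - ⟪b, x⟫ • b, b⟫ = 0 := by
    intro x
    rw [inner_sub_left, inner_smul_left, hbb, inner_conj_symm]; simp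
  have par : ∀ x : HSp n, ⟪x - ⟪b, x⟫ • b, x⟫ = 0 → x = ⟪b, x⟫ • b := by
    intro x hx
    have : ⟪x - ⟪b, x⟫ • b, x - ⟪b, x⟫ • b⟫ = 0 := by
      rw [inner_sub_right, hx, inner_smul_right, orth]; simp
    exact sub_eq_zero.1 (inner_self_eq_zero.1 this)
  have p1 := par b1 (key _ (orth b1)).1
  have p2 := par b2 (key _ (orth b2)).2
  have q1 : ‖⟪b, b1⟫‖ = 1 := by rw [p1, norm_smul, hb, mul_one] at hb1; exact hb1
  have q2 : ‖⟪b, b2⟫‖ = 1 := by rw [p2, norm_smul, hb, mul_one] at hb2; exact hb2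
  rw [p1, p2, inner_smul_left, inner_smul_right, hbb] at hB
  rw [norm_mul, norm_mul, RCLike.norm_conj, q1, q2] at hB
  simp at hB

/-- strict bound at each unit product vector -/
lemma strict {m n : ℕ} (a1 a2 a : HSp m) (b1 b2 b : HSp n)
    (ha1 : ‖a1‖ = 1) (ha2 : ‖a2‖ = 1) (hb1 : ‖b1‖ = 1) (hb2 : ‖b2‖ = 1)
    (ha : ‖a‖ = 1) (hb : ‖b‖ = 1)
    (hA : ‖⟪a1, a2⟫‖ < 1) (hB : ‖⟪b1, b2⟫‖ < 1) (hc : 0 < ‖⟪tmul a1 b1, tmul a2 b2⟫‖) :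
    ‖⟪tmul a1 b1, tmul a b⟫‖ ^ 2 + ‖⟪tmul a2 b2, tmul a b⟫‖ ^ 2 <
      1 + ‖⟪tmul a1 b1, tmul a2 b2⟫‖ := by
  have hp := norm_tmul_one a b ha hb
  have hψ1 := norm_tmul_one a1 b1 ha1 hb1
  have hψ2 := norm_tmul_one a2 b2 ha2 hb2
  have np := not_prod a1 a2 a b1 b2 b
  generalize hp' : tmul a b = p at *
  generalize tmul a1 b1 = ψ1 at *
  generalize tmul a2 b2 = ψ2 at *
  set z1 := ⟪ψ1, p⟫ with hz1
  set z2 := ⟪ψ2, p⟫ with hz2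
  set c := ‖⟪ψ1, ψ2⟫‖ with hcdef
  set S := ‖z1‖ ^ 2 + ‖z2‖ ^ 2 with hS
  by_contra hcon
  push Not at hcon
  set q := z1 • ψ1 + z2 • ψ2 with hq
  have hpq : ⟪q, p⟫ = (S : ℂ) := by
    rw [hq, inner_add_left, inner_smul_left, inner_smul_left, ← hz1, ← hz2,
      Complex.conj_mul', Complex.conj_mul', hS]
    push_cast; rfl
  have hqq : ‖q‖ ^ 2 ≤ S + 2 * (‖z1‖ * ‖z2‖ * c) := by
    rw [hq, @norm_add_sq ℂ, norm_smul, norm_smul, hψ1, hψ2, inner_smul_left, inner_smul_right]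
    have := Complex.re_le_norm ((starRingEnd ℂ) z1 * (z2 * ⟪ψ1, ψ2⟫))
    rw [norm_mul, norm_mul, RCLike.norm_conj] at this
    simp only [mul_one, RCLike.re_eq_complex_re]
    rw [hS]
    nlinarith
  have hsub : ‖q - (S : ℂ) • p‖ ^ 2 = ‖q‖ ^ 2 - S ^ 2 := by
    rw [@norm_sub_sq ℂ, inner_smul_right, hpq, norm_smul, hp]
    simp only [RCLike.re_eq_complex_re, mul_one, Complex.norm_real, Real.norm_eq_abs, sq_abs]
    rw [← Complex.ofReal_mul, Complex.ofReal_re]; ring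
  have hS0 : 0 < S := by linarith
  have hsq := sq_nonneg ‖q - (S : ℂ) • p‖
  have hle : S ^ 2 ≤ S + 2 * (‖z1‖ * ‖z2‖ * c) := by linarith
  have hSS : S * (1 + c) ≤ S ^ 2 := by nlinarith
  have hdiff : c * (‖z1‖ - ‖z2‖) ^ 2 ≤ 0 := by
    have : c * (‖z1‖ - ‖z2‖) ^ 2 = c * S - 2 * (‖z1‖ * ‖z2‖ * c) := by rw [hS]; ring
    rw [this]; linarith
  have heq : ‖z1‖ = ‖z2‖ := by
    have : (‖z1‖ - ‖z2‖) ^ 2 = 0 :=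
      le_antisymm (by by_contra h; push Not at h; nlinarith [mul_pos hc h]) (sq_nonneg _)
    have := pow_eq_zero_iff (two_ne_zero) |>.1 this
    linarith
  have hqp : q = (S : ℂ) • p := by
    have h1 : ‖q - (S : ℂ) • p‖ ^ 2 ≤ 0 := by
      rw [hsub]
      have : 2 * (‖z1‖ * ‖z2‖ * c) = c * S := by rw [hS, heq]; ring
      linarith
    have h2 : ‖q - (S : ℂ) • p‖ = 0 :=
      pow_eq_zero_iff (two_ne_zero) |>.1 (le_antisymm h1 hsq)
    exact sub_eq_zero.1 (norm_eq_zero.1 h2)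
  have hSc : (S : ℂ) ≠ 0 := by exact_mod_cast hS0.ne'
  have hz1n : z1 ≠ 0 := by
    intro h
    rw [h, norm_zero] at heq
    rw [hS, h, ← heq] at hS0
    simp at hS0
  have hz2n : z2 ≠ 0 := by
    intro h; rw [h, norm_zero, norm_eq_zero] at heq; exact hz1n heq
  refine np ((S : ℂ)⁻¹ * z1) ((S : ℂ)⁻¹ * z2) ha1 ha2 hb1 hb2 hb hA hB
    (mul_ne_zero (inv_ne_zero hSc) hz1n) (mul_ne_zero (inv_ne_zero hSc) hz2n) ?_
  rw [mul_smul, mul_smul, ← smul_add, ← hq, hqp, smul_smul, inv_mul_cancel₀ hSc, one_smul]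

lemma continuous_tmul {m n : ℕ} : Continuous fun x : HSp m × HSp n => tmul x.1 x.2 := by
  unfold tmul
  refine (PiLp.continuous_toLp 2 _).comp (continuous_pi fun p => ?_)
  fun_prop

lemma quad_eq {m n : ℕ} (p q x : HT m n) :
    (⟪x, ((1 : ℝ) • rankOne p + (1 : ℝ) • rankOne q) x⟫).re = ‖⟪p, x⟫‖ ^ 2 + ‖⟪q, x⟫‖ ^ 2 := by
  rw [M_apply, inner_add_right, inner_smul_right, inner_smul_right,
    ← inner_conj_symm x p, ← inner_conj_symm x q]
  simp only [Complex.ofReal_one, one_mul]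
  rw [Complex.mul_conj', Complex.mul_conj']
  norm_cast

lemma le_lamMax {m n : ℕ} (p q : HT m n) (hp : ‖p‖ = 1) (hq : ‖q‖ = 1) (hc : 0 < ‖⟪p, q⟫‖) :
    1 + ‖⟪p, q⟫‖ ≤ lamMax ((1 : ℝ) • rankOne p + (1 : ℝ) • rankOne q) := by
  have hs1 : ⟪p, p⟫ = 1 := by rw [inner_self_eq_norm_sq_to_K, hp]; simp
  have hs2 : ⟪q, q⟫ = 1 := by rw [inner_self_eq_norm_sq_to_K, hq]; simp
  have hM := M_apply 1 1 p q
  generalize (1 : ℝ) • rankOne p + (1 : ℝ) • rankOne q = M at hM ⊢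
  have hfin : Set.Finite {t : ℝ | Module.End.HasEigenvalue M (t : ℂ)} :=
    (Module.End.finite_hasEigenvalue M).preimage (Complex.ofReal_injective.injOn)
  refine le_csSup hfin.bddAbove ?_
  rw [Set.mem_ofPred_eq]
  have hg' : ⟪q, p⟫ = (starRingEnd ℂ) ⟪p, q⟫ := by rw [inner_conj_symm]
  generalize hg : ⟪p, q⟫ = g at *
  have hgc : (‖g‖ : ℂ) ≠ 0 := by exact_mod_cast hc.ne'
  have hgg : (starRingEnd ℂ) g * g = (‖g‖ : ℂ) ^ 2 := Complex.conj_mul' g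
  obtain ⟨u, hug, hu⟩ : ∃ u : ℂ, u * g = ‖g‖ ∧ (starRingEnd ℂ) g = ‖g‖ * u := by
    refine ⟨(‖g‖ : ℂ)⁻¹ * (starRingEnd ℂ) g, ?_, ?_⟩
    · rw [mul_assoc, hgg, sq, inv_mul_cancel_left₀ hgc]
    · rw [mul_inv_cancel_left₀ hgc]
  have hev : Module.End.HasEigenvector M ((1 + ‖g‖ : ℝ) : ℂ) (p + u • q) := by
    refine Module.End.hasEigenvector_iff.2 ⟨Module.End.mem_eigenspace_iff.2 ?_, ?_⟩
    · rw [hM, inner_add_right, inner_add_right, inner_smul_right, inner_smul_right, hs1, hs2,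
        hg', hg, hug, hu, smul_add, smul_smul]
      push_cast
      congr 2 <;> ring
    · intro h0
      have := congrArg (fun x => ⟪p, x⟫) h0
      simp only [inner_add_right, inner_smul_right, hs1, hg, hug, inner_zero_right] at this
      have h2 : (1 + ‖g‖ : ℝ) = 0 := by exact_mod_cast this
      linarith
  exact Module.End.hasEigenvalue_of_hasEigenvector hev

lemma exists_max {m n : ℕ} (p q : HT m n) (a1 : HSp m) (b1 : HSp n)
    (ha1 : ‖a1‖ = 1) (hb1 : ‖b1‖ = 1) :
    ∃ (a : HSp m) (b : HSp n), ‖a‖ = 1 ∧ ‖b‖ = 1 ∧ ∀ (a' : HSp m) (b' : HSp n),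
      ‖a'‖ = 1 → ‖b'‖ = 1 → ‖⟪p, tmul a' b'⟫‖ ^ 2 + ‖⟪q, tmul a' b'⟫‖ ^ 2 ≤
        ‖⟪p, tmul a b⟫‖ ^ 2 + ‖⟪q, tmul a b⟫‖ ^ 2 := by
  have hfc : Continuous (fun x : HSp m × HSp n =>
      ‖⟪p, tmul x.1 x.2⟫‖ ^ 2 + ‖⟪q, tmul x.1 x.2⟫‖ ^ 2) := by
    have h := @continuous_tmul m n
    have h1 : Continuous (fun x : HSp m × HSp n => ⟪p, tmul x.1 x.2⟫) := continuous_const.inner h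
    have h2 : Continuous (fun x : HSp m × HSp n => ⟪q, tmul x.1 x.2⟫) := continuous_const.inner h
    exact (h1.norm.pow 2).add (h2.norm.pow 2)
  have hK : IsCompact ((Metric.sphere (0 : HSp m) 1) ×ˢ (Metric.sphere (0 : HSp n) 1)) :=
    (isCompact_sphere _ _).prod (isCompact_sphere _ _)
  obtain ⟨x, hx, hmax⟩ := hK.exists_isMaxOn ⟨(a1, b1), by simp [ha1, hb1]⟩ hfc.continuousOn
  have hx' : ‖x.1‖ = 1 ∧ ‖x.2‖ = 1 := by simpa using hx
  refine ⟨x.1, x.2, hx'.1, hx'.2, fun a b ha hb => ?_⟩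
  have hab : (a, b) ∈ (Metric.sphere (0 : HSp m) 1) ×ˢ (Metric.sphere (0 : HSp n) 1) := by
    simp [ha, hb]
  exact isMaxOn_iff.1 hmax (a, b) hab

lemma backward {dA dB : ℕ}
    (a1 a2 : HSp dA) (b1 b2 : HSp dB)
    (ha1 : ‖a1‖ = 1) (ha2 : ‖a2‖ = 1) (hb1 : ‖b1‖ = 1) (hb2 : ‖b2‖ = 1)
    (h : 0 < ‖⟪a1, a2⟫‖ ∧ ‖⟪a1, a2⟫‖ < 1 ∧ 0 < ‖⟪b1, b2⟫‖ ∧ ‖⟪b1, b2⟫‖ < 1) :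
    sepSup ((1 : ℝ) • rankOne (tmul a1 b1) + (1 : ℝ) • rankOne (tmul a2 b2)) <
    lamMax ((1 : ℝ) • rankOne (tmul a1 b1) + (1 : ℝ) • rankOne (tmul a2 b2)) := by
  obtain ⟨hA0, hA, hB0, hB⟩ := h
  have hc : 0 < ‖⟪tmul a1 b1, tmul a2 b2⟫‖ := by
    rw [inner_tmul, norm_mul]; exact mul_pos hA0 hB0
  have hlam := le_lamMax _ _ (norm_tmul_one a1 b1 ha1 hb1) (norm_tmul_one a2 b2 ha2 hb2) hc
  refine lt_of_lt_of_le ?_ hlam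
  obtain ⟨a, b, ha, hb, hmax⟩ := exists_max (tmul a1 b1) (tmul a2 b2) a1 b1 ha1 hb1
  refine lt_of_le_of_lt ?_ (strict a1 a2 a b1 b2 b ha1 ha2 hb1 hb2 ha hb hA hB hc)
  refine csSup_le ⟨_, mem_sepSet _ a1 b1 ha1 hb1⟩ (sepSet_le _ _ fun a' b' ha' hb' => ?_)
  rw [quad_eq]
  exact hmax a' b' ha' hb'

/-- For linearly independent product unit vectors `ψ1 = a1 ⊗ b1` and
`ψ2 = a2 ⊗ b2`, there exist reals `n1, n2` with
`sup{Tr(σM) : σ separable} < λmax(M)` for `M = n1|ψ1⟩⟨ψ1| + n2|ψ2⟩⟨ψ2|`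
iff `0 < |⟨a1,a2⟩| < 1` and `0 < |⟨b1,b2⟩| < 1`. -/
theorem stmt_3 {dA dB : ℕ} (hdA : 2 ≤ dA) (hdB : 2 ≤ dB)
    (a1 a2 : HSp dA) (b1 b2 : HSp dB)
    (ha1 : ‖a1‖ = 1) (ha2 : ‖a2‖ = 1) (hb1 : ‖b1‖ = 1) (hb2 : ‖b2‖ = 1)
    (hli : LinearIndependent ℂ ![tmul a1 b1, tmul a2 b2]) :
    (∃ n1 n2 : ℝ,
        sepSup (n1 • rankOne (tmul a1 b1) + n2 • rankOne (tmul a2 b2)) <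
          lamMax (n1 • rankOne (tmul a1 b1) + n2 • rankOne (tmul a2 b2))) ↔
      (0 < ‖⟪a1, a2⟫‖ ∧ ‖⟪a1, a2⟫‖ < 1 ∧ 0 < ‖⟪b1, b2⟫‖ ∧ ‖⟪b1, b2⟫‖ < 1) := by
  constructor
  · rintro ⟨n1, n2, hn⟩
    by_contra hcon
    exact absurd hn (not_lt.2 (forward hdA hdB a1 a2 b1 b2 ha1 ha2 hb1 hb2 n1 n2 hcon))
  · intro h
    exact ⟨1, 1, backward a1 a2 b1 b2 ha1 ha2 hb1 hb2 h⟩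
end
end

section
/- Let ψ1, ψ2 be unit vectors in a finite-dimensional complex inner product space H with dim H ≥ 2, let c = |⟨ψ1, ψ2⟩|², let P_i = |ψ_i⟩⟨ψ_i|, and let V = span{ψ1, ψ2}. Then the joint numerical range L(P1, P2) = { (Tr(ρ P1), Tr(ρ P2)) : ρ a density operator on H } equals E_c if V^⊥ = {0}, and equals the convex hull of E_c ∪ {(0,0)} if V^⊥ ≠ {0}. -/
open scoped ComplexInnerProductSpace
noncomputable section

/-- For `c ∈ [0,1]`, the region
`E_c = {(x1,x2) ∈ [0,1]² : (x1 + x2 − (1 − c))² ≤ 4·c·x1·x2}`. -/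
def Ecal (c : ℝ) : Set (ℝ × ℝ) :=
  {x | x.1 ∈ Set.Icc (0 : ℝ) 1 ∧ x.2 ∈ Set.Icc (0 : ℝ) 1 ∧
    (x.1 + x.2 - (1 - c)) ^ 2 ≤ 4 * c * x.1 * x.2}

section aux
variable {H : Type*} [NormedAddCommGroup H] [InnerProductSpace ℂ H]

lemma rankOne_apply' (ψ x : H) : rankOne ψ x = ⟪ψ, x⟫ • ψ := by
  simp [rankOne]

variable [FiniteDimensional ℂ H]

lemma trace_rankOne' (T : H →ₗ[ℂ] H) (ψ : H) :
    LinearMap.trace ℂ H (T ∘ₗ rankOne ψ) = ⟪ψ, T ψ⟫ := by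
  have : T ∘ₗ rankOne ψ = ((innerSL ℂ ψ).toLinearMap).smulRight (T ψ) := by
    ext x
    simp [rankOne]
  rw [this, LinearMap.trace_smulRight]
  simp

lemma trace_rankOne_self (ψ : H) :
    LinearMap.trace ℂ H (rankOne ψ) = ⟪ψ, ψ⟫ := by
  have := trace_rankOne' (LinearMap.id : H →ₗ[ℂ] H) ψ
  simpa using this

lemma rankOne_symm (ψ : H) : LinearMap.IsSymmetric (rankOne ψ) := by
  intro x y
  simp only [rankOne_apply', inner_smul_left, inner_smul_right, inner_conj_symm]
  ring

lemma inner_rankOne_re (ψ x : H) : (⟪x, rankOne ψ x⟫).re = ‖⟪ψ, x⟫‖ ^ 2 := by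
  rw [rankOne_apply', inner_smul_right, ← inner_conj_symm x ψ, Complex.mul_conj,
    Complex.normSq_eq_norm_sq, Complex.ofReal_re]

/-- the joint numerical range -/
def jrange (ψ1 ψ2 : H) : Set (ℝ × ℝ) :=
  {x : ℝ × ℝ | ∃ ρ : H →ₗ[ℂ] H, IsDensity ρ ∧
          x = ((LinearMap.trace ℂ H (ρ ∘ₗ rankOne ψ1)).re,
               (LinearMap.trace ℂ H (ρ ∘ₗ rankOne ψ2)).re)}

lemma jrange_convex (ψ1 ψ2 : H) : Convex ℝ (jrange ψ1 ψ2) := by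
  rintro _ ⟨ρ, ⟨h1, h2, h3⟩, rfl⟩ _ ⟨σ, ⟨k1, k2, k3⟩, rfl⟩ a b ha hb hab
  refine ⟨(a : ℂ) • ρ + (b : ℂ) • σ, ⟨?_, ?_, ?_⟩, ?_⟩
  · exact (h1.smul (by simp)).add (k1.smul (by simp))
  · intro x
    have := mul_nonneg ha (h2 x)
    have := mul_nonneg hb (k2 x)
    simp [inner_add_right, inner_smul_right]
    linarith
  · simp only [map_add, map_smul, h3, k3, smul_eq_mul, mul_one]
    exact_mod_cast hab
  · simp only [trace_rankOne']
    simp [inner_add_right, inner_smul_right]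

lemma frame_exists (hH : 2 ≤ Module.finrank ℂ H)
    (ψ1 ψ2 : H) (hψ1 : ‖ψ1‖ = 1) (hψ2 : ‖ψ2‖ = 1)
    (c : ℝ) (hc : c = ‖⟪ψ1, ψ2⟫‖ ^ 2) :
    ∃ (e f : H) (ω : ℂ), ‖ω‖ = 1 ∧ ‖e‖ = 1 ∧ ‖f‖ = 1 ∧ ⟪e, f⟫ = 0 ∧ ψ1 = ω • e ∧
      ψ2 = ((√c : ℝ) : ℂ) • e + ((√(1 - c) : ℝ) : ℂ) • f := by
  have hsc : √c = ‖⟪ψ1, ψ2⟫‖ := by rw [hc, Real.sqrt_sq (norm_nonneg _)]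
  -- the phase
  obtain ⟨z, hz, hza⟩ : ∃ z : ℂ, ‖z‖ = 1 ∧ ⟪ψ1, ψ2⟫ = ((√c : ℝ) : ℂ) * z := by
    rw [hsc]
    by_cases h0 : ⟪ψ1, ψ2⟫ = 0
    · exact ⟨1, by simp, by simp [h0]⟩
    · have : ‖⟪ψ1, ψ2⟫‖ ≠ 0 := by simpa using h0
      refine ⟨⟪ψ1, ψ2⟫ / (‖⟪ψ1, ψ2⟫‖ : ℂ), ?_, ?_⟩
      · simp [this]
      · have : ((‖⟪ψ1, ψ2⟫‖ : ℝ) : ℂ) ≠ 0 := by exact_mod_cast this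
        field_simp
  have hz0 : z ≠ 0 := by rintro rfl; simp at hz
  have hzz : (starRingEnd ℂ) z * z = 1 := by
    rw [mul_comm, Complex.mul_conj, Complex.normSq_eq_norm_sq, hz]; simp
  have h11 : ⟪ψ1, ψ1⟫ = 1 := by rw [inner_self_eq_norm_sq_to_K, hψ1]; simp
  have h22 : ⟪ψ2, ψ2⟫ = 1 := by rw [inner_self_eq_norm_sq_to_K, hψ2]; simp
  set e : H := z • ψ1 with he
  have hee : ‖e‖ = 1 := by rw [he, norm_smul, hz, hψ1, one_mul]
  have h1e : ψ1 = (starRingEnd ℂ z) • e := by rw [he, smul_smul, hzz, one_smul]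
  have hIe : ⟪e, e⟫ = 1 := by rw [inner_self_eq_norm_sq_to_K, hee]; simp
  have he2 : ⟪e, ψ2⟫ = ((√c : ℝ) : ℂ) := by
    rw [he, inner_smul_left, hza]
    linear_combination ((√c : ℝ) : ℂ) * hzz
  have hc0 : 0 ≤ c := by rw [hc]; positivity
  set w : H := ψ2 - ((√c : ℝ) : ℂ) • e with hw
  have hew : ⟪e, w⟫ = 0 := by
    rw [hw, inner_sub_right, inner_smul_right, he2, hIe]; ring
  have hww : ‖w‖ ^ 2 = 1 - c := by
    have h := norm_add_sq_eq_norm_sq_add_norm_sq_of_inner_eq_zero (𝕜 := ℂ) (((√c : ℝ) : ℂ) • e) w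
      (by rw [inner_smul_left, hew, mul_zero])
    rw [hw, add_sub_cancel, hψ2, norm_smul, hee, ← hw] at h
    have : ‖((√c : ℝ) : ℂ)‖ = √c := by simp [abs_of_nonneg (Real.sqrt_nonneg c)]
    rw [this] at h
    nlinarith [Real.mul_self_sqrt hc0]
  have hwn : √(1 - c) = ‖w‖ := by rw [← hww, Real.sqrt_sq (norm_nonneg _)]
  obtain ⟨f, hf, hef, hwf⟩ : ∃ f : H, ‖f‖ = 1 ∧ ⟪e, f⟫ = 0 ∧ w = ((√(1 - c) : ℝ) : ℂ) • f := by
    rw [hwn]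
    by_cases h0 : w = 0
    · have hne : (Submodule.span ℂ {e})ᗮ ≠ ⊥ := by
        intro hb
        have h1 := Submodule.finrank_add_finrank_orthogonal (𝕜 := ℂ) (Submodule.span ℂ {e})
        rw [hb, finrank_bot] at h1
        have h2 := finrank_span_singleton (K := ℂ) (v := e) (by rintro h; simp [h] at hee)
        omega
      obtain ⟨g, hg, hg0⟩ := Submodule.exists_mem_ne_zero_of_ne_bot hne
      rw [Submodule.mem_orthogonal_singleton_iff_inner_right] at hg
      refine ⟨((‖g‖⁻¹ : ℝ) : ℂ) • g, ?_, ?_, ?_⟩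
      · rw [norm_smul]
        have : ‖g‖ ≠ 0 := by simpa using hg0
        simp [this]
      · rw [inner_smul_right, hg, mul_zero]
      · simp [h0]
    · have hn : ‖w‖ ≠ 0 := by simpa using h0
      refine ⟨((‖w‖⁻¹ : ℝ) : ℂ) • w, ?_, ?_, ?_⟩
      · rw [norm_smul]
        simp [hn]
      · rw [inner_smul_right, hew, mul_zero]
      · rw [smul_smul, ← Complex.ofReal_mul, mul_inv_cancel₀ hn]; simp
  exact ⟨e, f, starRingEnd ℂ z, by simpa using hz, hee, hf, hef, h1e, by rw [← hwf, hw]; simp⟩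

lemma alg1 (c p q y : ℝ) (hc0 : 0 ≤ c) (hc1 : c ≤ 1) (hp : 0 ≤ p) (hq : 0 ≤ q) (hpq : p + q = 1)
    (hy : y ^ 2 ≤ p * q) :
    (p, c * p + (1 - c) * q + 2 * (√c * √(1 - c)) * y) ∈ Ecal c := by
  have ha := Real.sq_sqrt hc0
  have hb := Real.sq_sqrt (sub_nonneg.2 hc1)
  have ha0 := Real.sqrt_nonneg c
  have hb0 := Real.sqrt_nonneg (1 - c)
  generalize √c = a at *
  generalize √(1 - c) = b at *
  obtain rfl : q = 1 - p := by linarith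
  have hab : (a * b) ^ 2 = c * (1 - c) := by rw [mul_pow, ha, hb]
  have hcc : 0 ≤ c * (1 - c) := mul_nonneg hc0 (by linarith)
  -- AM-GM bounds
  have key : ∀ u v : ℝ, 0 ≤ u → 0 ≤ v → u * v = c * (1 - c) * (p * (1 - p)) →
      |2 * (a * b) * y| ≤ u + v := by
    intro u v hu hv huv
    apply abs_le_of_sq_le_sq _ (by linarith)
    have : (2 * (a * b) * y) ^ 2 = 4 * (c * (1 - c)) * y ^ 2 := by
      rw [← hab]; ring
    rw [this]
    nlinarith [sq_nonneg (u - v), mul_le_mul_of_nonneg_left hy hcc]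
  have k1 := abs_le.1 (key (c * p) ((1 - c) * (1 - p)) (mul_nonneg hc0 hp)
    (mul_nonneg (by linarith) hq) (by ring))
  have k2 := abs_le.1 (key ((1 - c) * p) (c * (1 - p)) (mul_nonneg (by linarith) hp)
    (mul_nonneg hc0 hq) (by ring))
  refine ⟨⟨hp, by simp only; linarith⟩, ⟨by simp only; linarith [k1.1], by simp only; linarith [k2.2]⟩, ?_⟩
  simp only
  have : (2 * (a * b) * y) ^ 2 ≤ 4 * (c * (1 - c)) * (p * (1 - p)) := by
    have : (2 * (a * b) * y) ^ 2 = 4 * (c * (1 - c)) * y ^ 2 := by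
      rw [← hab]; ring
    rw [this]
    nlinarith [mul_le_mul_of_nonneg_left hy hcc]
  nlinarith [this]

lemma alg2 (c x1 x2 : ℝ) (hc0 : 0 ≤ c) (hc1 : c ≤ 1) (h : (x1, x2) ∈ Ecal c) :
    ∃ s : ℝ, s ^ 2 ≤ 1 ∧ x2 = c * x1 + (1 - c) * (1 - x1) +
      2 * (√c * √(1 - c) * (√x1 * √(1 - x1))) * s := by
  obtain ⟨⟨h1, h2⟩, -, h3⟩ := h
  simp only at h1 h2 h3
  set B := 2 * (√c * √(1 - c) * (√x1 * √(1 - x1))) with hB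
  have hB2 : B ^ 2 = 4 * (c * (1 - c) * (x1 * (1 - x1))) := by
    rw [hB, mul_pow, mul_pow, mul_pow, mul_pow, Real.sq_sqrt hc0, Real.sq_sqrt h1,
      Real.sq_sqrt (sub_nonneg.2 hc1), Real.sq_sqrt (sub_nonneg.2 h2)]
    ring
  have hD : (x2 - (c * x1 + (1 - c) * (1 - x1))) ^ 2 ≤ B ^ 2 := by
    rw [hB2]; nlinarith
  by_cases h0 : B = 0
  · refine ⟨0, by norm_num, ?_⟩
    rw [h0] at hD
    have : x2 - (c * x1 + (1 - c) * (1 - x1)) = 0 := by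
      apply pow_eq_zero_iff (two_ne_zero) |>.1
      nlinarith [sq_nonneg (x2 - (c * x1 + (1 - c) * (1 - x1)))]
    linarith
  · refine ⟨(x2 - (c * x1 + (1 - c) * (1 - x1))) / B, ?_, ?_⟩
    · rw [div_pow]
      exact div_le_one_of_le₀ hD (sq_nonneg _)
    · field_simp; ring

/-- E_c is in the range -/
lemma Ecal_subset (c : ℝ) (hc0 : 0 ≤ c) (hc1 : c ≤ 1) (ψ1 ψ2 e f : H) (ω : ℂ) (hω : ‖ω‖ = 1)
    (he : ‖e‖ = 1) (hf : ‖f‖ = 1) (hef : ⟪e, f⟫ = 0) (h1 : ψ1 = ω • e)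
    (h2 : ψ2 = ((√c : ℝ) : ℂ) • e + ((√(1 - c) : ℝ) : ℂ) • f) :
    Ecal c ⊆ jrange ψ1 ψ2 := by
  rintro ⟨x1, x2⟩ hx
  obtain ⟨s, hs, hx2⟩ := alg2 c x1 x2 hc0 hc1 hx
  obtain ⟨⟨hx0, hx1⟩, -, -⟩ := hx
  simp only at hx0 hx1
  have hIe : ⟪e, e⟫ = 1 := by rw [inner_self_eq_norm_sq_to_K, he]; simp
  have hIf : ⟪f, f⟫ = 1 := by rw [inner_self_eq_norm_sq_to_K, hf]; simp
  have hfe : ⟪f, e⟫ = 0 := by rw [← inner_conj_symm, hef, map_zero]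
  set u : H := ((√x1 : ℝ) : ℂ) • e + ((√(1 - x1) * s : ℝ) : ℂ) • f with hu
  set v : H := ((√(1 - x1) * √(1 - s ^ 2) : ℝ) : ℂ) • f with hv
  have A := Real.sq_sqrt hc0
  have B := Real.sq_sqrt (sub_nonneg.2 hc1)
  have C := Real.sq_sqrt hx0
  have D := Real.sq_sqrt (sub_nonneg.2 hx1)
  have E := Real.sq_sqrt (sub_nonneg.2 hs)
  refine ⟨rankOne u + rankOne v, ⟨(rankOne_symm u).add (rankOne_symm v), ?_, ?_⟩, ?_⟩
  · intro x
    rw [LinearMap.add_apply, inner_add_right, Complex.add_re, inner_rankOne_re, inner_rankOne_re]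
    positivity
  · rw [map_add, trace_rankOne_self, trace_rankOne_self, hu, hv]
    simp only [inner_add_left, inner_add_right, inner_smul_left, inner_smul_right, hIe, hIf, hef,
      hfe, Complex.conj_ofReal]
    norm_cast
    simp only [mul_one, mul_zero, add_zero, zero_add]
    norm_cast
    linear_combination C + D + (√(1 - x1)) ^ 2 * E
  · simp only [trace_rankOne', LinearMap.add_apply, inner_add_right, Complex.add_re,
      inner_rankOne_re]
    ext
    · simp only [h1, hu, hv, inner_add_left, inner_smul_left, inner_smul_right, hIe, hfe, norm_mul, hω,
        Complex.conj_ofReal, mul_zero, add_zero, mul_one, one_mul, norm_zero, Complex.norm_real,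
        Real.norm_eq_abs, sq_abs]
      rw [C]; ring
    · simp only [h2, hu, hv, inner_add_left, inner_add_right, inner_smul_left, inner_smul_right,
        hIe, hIf, hef, hfe, Complex.conj_ofReal, mul_zero, add_zero, zero_add, mul_one]
      simp only [← Complex.ofReal_mul, ← Complex.ofReal_add, Complex.norm_real,
        Real.norm_eq_abs, sq_abs]
      rw [hx2]
      generalize √c = a at *
      generalize √(1 - c) = b at *
      generalize √x1 = p at *
      generalize √(1 - x1) = q at *
      generalize √(1 - s ^ 2) = t at *
      linear_combination (-x1) * A - a ^ 2 * C - (1 - x1) * B - b ^ 2 * D - q ^ 2 * b ^ 2 * E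

/-- data of a density operator on the frame -/
lemma density_data (c : ℝ) (hc0 : 0 ≤ c) (hc1 : c ≤ 1) (ψ1 ψ2 e f : H) (ω : ℂ) (hω : ‖ω‖ = 1)
    (he : ‖e‖ = 1) (hf : ‖f‖ = 1) (hef : ⟪e, f⟫ = 0) (h1 : ψ1 = ω • e)
    (h2 : ψ2 = ((√c : ℝ) : ℂ) • e + ((√(1 - c) : ℝ) : ℂ) • f) (x : ℝ × ℝ)
    (hx : x ∈ jrange ψ1 ψ2) :
    ∃ p q y : ℝ, 0 ≤ p ∧ 0 ≤ q ∧ p + q ≤ 1 ∧ y ^ 2 ≤ p * q ∧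
      ((Submodule.span ℂ {ψ1, ψ2})ᗮ = ⊥ → p + q = 1) ∧
      x = (p, c * p + (1 - c) * q + 2 * (√c * √(1 - c)) * y) := by
  obtain ⟨ρ, ⟨hs, hp, ht⟩, rfl⟩ := hx
  have hA := Real.sq_sqrt hc0
  have hB := Real.sq_sqrt (sub_nonneg.2 hc1)
  have hfe : ⟪f, e⟫ = 0 := by rw [← inner_conj_symm, hef, map_zero]
  have hsym : (⟪f, ρ e⟫).re = (⟪e, ρ f⟫).re := by
    rw [← hs f e, ← inner_conj_symm, Complex.conj_re]
  have hquad : ∀ s t : ℝ, (⟪(s : ℂ) • e + (t : ℂ) • f, ρ ((s : ℂ) • e + (t : ℂ) • f)⟫).re =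
      s ^ 2 * (⟪e, ρ e⟫).re + t ^ 2 * (⟪f, ρ f⟫).re + 2 * (s * t) * (⟪e, ρ f⟫).re := by
    intro s t
    simp only [map_add, map_smul, inner_add_left, inner_add_right, inner_smul_left,
      inner_smul_right, Complex.conj_ofReal, Complex.add_re, Complex.re_ofReal_mul, hsym]
    ring
  have hq0 : ∀ s t : ℝ, 0 ≤ s ^ 2 * (⟪e, ρ e⟫).re + t ^ 2 * (⟪f, ρ f⟫).re
      + 2 * (s * t) * (⟪e, ρ f⟫).re := fun s t => by rw [← hquad]; exact hp _
  have hne : e ≠ f := by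
    rintro rfl
    rw [inner_self_eq_norm_sq_to_K, he] at hef
    simp at hef
  classical
  -- orthonormal basis
  have hon : Orthonormal ℂ ((↑) : ({e, f} : Set H) → H) := by
    rw [orthonormal_subtype_iff_ite]
    have hIe : ⟪e, e⟫ = 1 := by rw [inner_self_eq_norm_sq_to_K, he]; simp
    have hIf : ⟪f, f⟫ = 1 := by rw [inner_self_eq_norm_sq_to_K, hf]; simp
    rintro a (rfl | rfl) b (rfl | rfl)
    · rw [if_pos rfl, hIe]
    · simp [hef, hne]
    · simp [hfe, hne.symm]
    · rw [if_pos rfl, hIf]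
  obtain ⟨u, b, hub, hb⟩ := hon.exists_orthonormalBasis_extension
  have htr : ∑ i ∈ u, (⟪i, ρ i⟫).re = 1 := by
    rw [LinearMap.trace_eq_sum_inner ρ b] at ht
    have := congrArg Complex.re ht
    rw [Complex.re_sum, hb] at this
    rw [← Finset.sum_coe_sort u]
    simpa using this
  have hsub : ({e, f} : Finset H) ⊆ u := by
    intro a ha
    apply Finset.mem_coe.1
    apply hub
    simpa using ha
  have hpair : ∑ i ∈ ({e, f} : Finset H), (⟪i, ρ i⟫).re = (⟪e, ρ e⟫).re + (⟪f, ρ f⟫).re :=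
    Finset.sum_pair hne
  refine ⟨(⟪e, ρ e⟫).re, (⟪f, ρ f⟫).re, (⟪e, ρ f⟫).re, hp e, hp f, ?_, ?_, ?_, ?_⟩
  · rw [← htr, ← hpair]
    exact Finset.sum_le_sum_of_subset_of_nonneg hsub fun i _ _ => hp i
  · have hp' := hp e
    have hq' := hp f
    generalize (⟪e, ρ e⟫).re = p at *
    generalize (⟪f, ρ f⟫).re = q at *
    generalize (⟪e, ρ f⟫).re = y at *
    have k1 := hq0 q (-y)
    have k2 := hq0 y (-p)
    have k3 := hq0 1 1
    have k4 := hq0 1 (-1)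
    rcases hp'.lt_or_eq with h | h
    · by_contra hcon
      push Not at hcon
      nlinarith [mul_pos h (sub_pos.2 hcon)]
    · rcases hq'.lt_or_eq with h' | h'
      · by_contra hcon
        push Not at hcon
        nlinarith [mul_pos h' (sub_pos.2 hcon)]
      · rw [← h, ← h'] at k3 k4 ⊢
        have : y = 0 := by linarith
        simp [this]
  · intro hV
    rw [← htr, ← hpair]
    congr 1
    apply Finset.Subset.antisymm hsub
    intro g hg
    by_contra hgn
    simp only [Finset.mem_insert, Finset.mem_singleton, not_or] at hgn
    have horth : ∀ a ∈ u, a ≠ g → ⟪a, g⟫ = 0 := by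
      intro a ha hag
      have := b.orthonormal.2 (i := ⟨a, ha⟩) (j := ⟨g, hg⟩) (by simpa using hag)
      simpa [hb] using this
    have hge := horth e (hsub (by simp)) (Ne.symm hgn.1)
    have hgf := horth f (hsub (by simp)) (Ne.symm hgn.2)
    have hgn1 : ‖g‖ = 1 := by
      have := b.orthonormal.1 ⟨g, hg⟩
      simpa [hb] using this
    have : g ∈ (Submodule.span ℂ {ψ1, ψ2})ᗮ := by
      rw [Submodule.mem_orthogonal]
      intro a ha
      induction ha using Submodule.span_induction with
      | mem a ha =>
        rcases ha with rfl | rfl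
        · rw [h1, inner_smul_left, hge, mul_zero]
        · rw [h2, inner_add_left, inner_smul_left, inner_smul_left, hge, hgf]; simp
      | zero => simp
      | add a b _ _ ha hb => rw [inner_add_left, ha, hb, add_zero]
      | smul r a _ ha => rw [inner_smul_left, ha, mul_zero]
    rw [hV, Submodule.mem_bot] at this
    simp [this] at hgn1
  · rw [trace_rankOne', trace_rankOne']
    ext
    · simp only [h1, map_smul, inner_smul_left, inner_smul_right]
      rw [← mul_assoc, mul_comm ω, ] 
      have : (starRingEnd ℂ) ω * ω = 1 := by
        rw [mul_comm, Complex.mul_conj, Complex.normSq_eq_norm_sq, hω]; simp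
      first
        | rw [this, one_mul]
        | (rw [mul_comm ω] ; rw [this, one_mul])
    · simp only [h2, hquad]
      rw [hA, hB]

end aux

theorem stmt_11 {H : Type*} [NormedAddCommGroup H] [InnerProductSpace ℂ H]
    [FiniteDimensional ℂ H] (hH : 2 ≤ Module.finrank ℂ H)
    (ψ1 ψ2 : H) (hψ1 : ‖ψ1‖ = 1) (hψ2 : ‖ψ2‖ = 1)
    (c : ℝ) (hc : c = ‖⟪ψ1, ψ2⟫‖ ^ 2) :
    ((Submodule.span ℂ {ψ1, ψ2})ᗮ = ⊥ →
      {x : ℝ × ℝ | ∃ ρ : H →ₗ[ℂ] H, IsDensity ρ ∧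
          x = ((LinearMap.trace ℂ H (ρ ∘ₗ rankOne ψ1)).re,
               (LinearMap.trace ℂ H (ρ ∘ₗ rankOne ψ2)).re)} = Ecal c) ∧
    ((Submodule.span ℂ {ψ1, ψ2})ᗮ ≠ ⊥ →
      {x : ℝ × ℝ | ∃ ρ : H →ₗ[ℂ] H, IsDensity ρ ∧
          x = ((LinearMap.trace ℂ H (ρ ∘ₗ rankOne ψ1)).re,
               (LinearMap.trace ℂ H (ρ ∘ₗ rankOne ψ2)).re)} =
        convexHull ℝ (insert ((0 : ℝ), (0 : ℝ)) (Ecal c))) := by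
  have hc0 : 0 ≤ c := by rw [hc]; positivity
  have hc1 : c ≤ 1 := by
    have := norm_inner_le_norm (𝕜 := ℂ) ψ1 ψ2
    rw [hψ1, hψ2, mul_one] at this
    rw [hc]
    exact pow_le_one₀ (norm_nonneg _) this
  obtain ⟨e, f, ω, hω, he, hf, hef, h1, h2⟩ := frame_exists hH ψ1 ψ2 hψ1 hψ2 c hc
  have hsub := Ecal_subset c hc0 hc1 ψ1 ψ2 e f ω hω he hf hef h1 h2
  have hdata := density_data c hc0 hc1 ψ1 ψ2 e f ω hω he hf hef h1 h2
  constructor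
  · intro hV
    change jrange ψ1 ψ2 = _
    apply Set.Subset.antisymm _ hsub
    intro x hx
    obtain ⟨p, q, y, hp, hq, -, hy, h, rfl⟩ := hdata x hx
    exact alg1 c p q y hc0 hc1 hp hq (h hV) hy
  · intro hV
    change jrange ψ1 ψ2 = _
    apply Set.Subset.antisymm
    · intro x hx
      obtain ⟨p, q, y, hp, hq, hpq, hy, -, rfl⟩ := hdata x hx
      have hc := convex_convexHull ℝ (insert ((0 : ℝ), (0 : ℝ)) (Ecal c))
      have h0 : ((0 : ℝ), (0 : ℝ)) ∈ convexHull ℝ (insert ((0 : ℝ), (0 : ℝ)) (Ecal c)) :=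
        subset_convexHull ℝ _ (Set.mem_insert _ _)
      rcases (add_nonneg hp hq).lt_or_eq with ht | ht
      · set t := p + q with htdef
        have hm := alg1 c (p / t) (q / t) (y / t) hc0 hc1 (by positivity) (by positivity)
          (by rw [← add_div, ← htdef, div_self ht.ne'])
          (by rw [div_pow, div_mul_div_comm, ← sq]; gcongr)
        have hm' := subset_convexHull ℝ _ (Set.mem_insert_of_mem ((0 : ℝ), (0 : ℝ)) hm)
        have := hc hm' h0 ht.le (sub_nonneg.2 hpq) (by ring)
        convert this using 1
        ext
        · simp; field_simp
        · simp; field_simp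
      · have hp0 : p = 0 := by linarith
        have hq0 : q = 0 := by linarith
        subst hp0 hq0
        have hy0 : y = 0 := by
          apply pow_eq_zero_iff (two_ne_zero) |>.1
          nlinarith [sq_nonneg y]
        subst hy0
        simpa using h0
    · apply convexHull_min _ (jrange_convex ψ1 ψ2)
      rw [Set.insert_subset_iff]
      refine ⟨?_, hsub⟩
      obtain ⟨g, hg, hg0⟩ := Submodule.exists_mem_ne_zero_of_ne_bot hV
      have hgn : ‖g‖ ≠ 0 := by simpa using hg0
      rw [Submodule.mem_orthogonal'] at hg
      have hg1 := hg ψ1 (Submodule.subset_span (by simp))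
      have hg2 := hg ψ2 (Submodule.subset_span (by simp))
      refine ⟨rankOne (((‖g‖⁻¹ : ℝ) : ℂ) • g), ⟨rankOne_symm _, ?_, ?_⟩, ?_⟩
      · intro x
        rw [inner_rankOne_re]; positivity
      · rw [trace_rankOne_self, inner_self_eq_norm_sq_to_K, norm_smul]
        simp [hgn]
      · simp only [trace_rankOne', inner_rankOne_re, inner_smul_left, hg1, hg2]
        simp
end
end

section
/- Let a1, a2 ∈ H_A and b1, b2 ∈ H_B be unit vectors, set ψ1 = a1 ⊗ b1, ψ2 = a2 ⊗ b2, P_j = |ψ_j⟩⟨ψ_j|, c_A = |⟨a1, a2⟩|², and c_B = |⟨b1, b2⟩|². Then the joint separable numerical range L_SEP(P1, P2) = { (Tr(σ P1), Tr(σ P2)) : σ a separable density operator on H_A ⊗ H_B } equals the convex hull of the set S = { (x_{1,A}·x_{1,B}, x_{2,A}·x_{2,B}) : (x_{1,A}, x_{2,A}) ∈ E_{c_A}, (x_{1,B}, x_{2,B}) ∈ E_{c_B} }. -/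
open scoped ComplexInnerProductSpace
noncomputable section

lemma aux_exists_orth {d : ℕ} (hd : 2 ≤ d) (a : HSp d) (ha : ‖a‖ = 1) :
    ∃ e : HSp d, ‖e‖ = 1 ∧ ⟪a, e⟫ = 0 := by
  have hne : (ℂ ∙ a)ᗮ ≠ ⊥ := by
    intro h
    rw [Submodule.orthogonal_eq_bot_iff] at h
    have ha0 : a ≠ 0 := by
      intro h0
      rw [h0] at ha
      simp at ha
    have h1 := finrank_span_singleton (K := ℂ) ha0
    rw [h, finrank_top, finrank_euclideanSpace_fin] at h1
    omega
  obtain ⟨v, hv, hv0⟩ := Submodule.exists_mem_ne_zero_of_ne_bot hne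
  rw [Submodule.mem_orthogonal_singleton_iff_inner_right] at hv
  refine ⟨((‖v‖⁻¹ : ℝ) : ℂ) • v, ?_, ?_⟩
  · rw [norm_smul]
    simp [hv0]
  · rw [inner_smul_right, hv, mul_zero]

lemma aux_frame {d : ℕ} (hd : 2 ≤ d) (a1 a2 : HSp d) (ha1 : ‖a1‖ = 1) (ha2 : ‖a2‖ = 1) :
    ∃ (e : HSp d) (β : ℝ), ‖e‖ = 1 ∧ ⟪a1, e⟫ = 0 ∧
      a2 = ⟪a1, a2⟫ • a1 + (β : ℂ) • e ∧ β ^ 2 = 1 - ‖⟪a1, a2⟫‖ ^ 2 := by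
  have key : ∃ (e : HSp d) (β : ℝ), ‖e‖ = 1 ∧ ⟪a1, e⟫ = 0 ∧
      a2 = ⟪a1, a2⟫ • a1 + (β : ℂ) • e := by
    by_cases hw : a2 - ⟪a1, a2⟫ • a1 = 0
    · obtain ⟨e, he, hae⟩ := aux_exists_orth hd a1 ha1
      refine ⟨e, 0, he, hae, ?_⟩
      simpa using sub_eq_zero.mp hw
    · have hn : ‖a2 - ⟪a1, a2⟫ • a1‖ ≠ 0 := norm_ne_zero_iff.mpr hw
      refine ⟨((‖a2 - ⟪a1, a2⟫ • a1‖⁻¹ : ℝ) : ℂ) • (a2 - ⟪a1, a2⟫ • a1),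
        ‖a2 - ⟪a1, a2⟫ • a1‖, ?_, ?_, ?_⟩
      · rw [norm_smul]
        simp [hn]
      · rw [inner_smul_right, inner_sub_right, inner_smul_right, inner_self_eq_norm_sq_to_K, ha1]
        simp
      · rw [smul_smul, ← Complex.ofReal_mul, mul_inv_cancel₀ hn]
        simp
  obtain ⟨e, β, he, hae, h⟩ := key
  refine ⟨e, β, he, hae, h, ?_⟩
  have h2 : ‖a2‖ * ‖a2‖ = ‖⟪a1, a2⟫ • a1‖ * ‖⟪a1, a2⟫ • a1‖ + ‖(β : ℂ) • e‖ * ‖(β : ℂ) • e‖ := by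
    conv_lhs => rw [h]
    apply norm_add_sq_eq_norm_sq_add_norm_sq_of_inner_eq_zero (𝕜 := ℂ)
    rw [inner_smul_left, inner_smul_right, hae]
    simp
  rw [norm_smul, norm_smul, ha2, ha1, he] at h2
  have : ‖(β : ℂ)‖ * ‖(β : ℂ)‖ = β ^ 2 := by
    rw [Complex.norm_real, Real.norm_eq_abs, abs_mul_abs_self, sq]
  simp only [mul_one] at h2
  rw [this] at h2
  linarith [sq ‖⟪a1, a2⟫‖]

lemma aux_inner_a2 {d : ℕ} (α : ℂ) (β : ℝ) (a1 e φ : HSp d) :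
    ⟪α • a1 + (β : ℂ) • e, φ⟫ = (starRingEnd ℂ α) * ⟪a1, φ⟫ + β * ⟪e, φ⟫ := by
  rw [inner_add_left, inner_smul_left, inner_smul_left, Complex.conj_ofReal]

lemma aux_bessel {d : ℕ} (a1 e φ : HSp d) (ha1 : ‖a1‖ = 1) (he : ‖e‖ = 1)
    (hae : ⟪a1, e⟫ = 0) (hφ : ‖φ‖ = 1) : ‖⟪a1, φ⟫‖ ^ 2 + ‖⟪e, φ⟫‖ ^ 2 ≤ 1 := by
  have ho : Orthonormal ℂ ![a1, e] := by
    constructor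
    · intro i
      fin_cases i <;> simp [ha1, he]
    · intro i j hij
      have hea : ⟪e, a1⟫ = 0 := inner_eq_zero_symm.mp hae
      fin_cases i <;> fin_cases j <;> simp_all
  have := ho.sum_inner_products_le (x := φ) (s := Finset.univ)
  simpa [Fin.sum_univ_two, hφ] using this

/-- The scalar inequality behind the forward inclusion. -/
lemma aux_scalar (α p q : ℂ) (β : ℝ) (hβ : β ^ 2 = 1 - ‖α‖ ^ 2) :
    ‖(starRingEnd ℂ α) * p + β * q‖ ^ 2 ≤ ‖p‖ ^ 2 + ‖q‖ ^ 2 ∧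
    (‖p‖ ^ 2 + ‖(starRingEnd ℂ α) * p + β * q‖ ^ 2
        - (‖p‖ ^ 2 + ‖q‖ ^ 2) * (1 - ‖α‖ ^ 2)) ^ 2
      ≤ 4 * ‖α‖ ^ 2 * ‖p‖ ^ 2 * ‖(starRingEnd ℂ α) * p + β * q‖ ^ 2 := by
  set z : ℂ := (starRingEnd ℂ α) * p with hz
  have hzn : ‖z‖ ^ 2 = ‖α‖ ^ 2 * ‖p‖ ^ 2 := by
    rw [hz, norm_mul, mul_pow, RCLike.norm_conj]
  have hw2 : ‖z + β * q‖ ^ 2 = ‖z‖ ^ 2 + β ^ 2 * ‖q‖ ^ 2 + 2 * β * (z.re * q.re + z.im * q.im) := by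
    simp only [← Complex.normSq_eq_norm_sq, Complex.normSq_apply]
    simp
    ring
  have hcs : (z.re * q.re + z.im * q.im) ^ 2 ≤ ‖z‖ ^ 2 * ‖q‖ ^ 2 := by
    simp only [← Complex.normSq_eq_norm_sq, Complex.normSq_apply]
    nlinarith [sq_nonneg (z.re * q.im - z.im * q.re)]
  set r := z.re * q.re + z.im * q.im with hr
  constructor
  · -- Cauchy-Schwarz
    have h1 : ‖z + β * q‖ ≤ ‖α‖ * ‖p‖ + |β| * ‖q‖ := by
      refine (norm_add_le _ _).trans ?_
      rw [hz, norm_mul, norm_mul, RCLike.norm_conj, Complex.norm_real, Real.norm_eq_abs]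
    have h2 : ‖z + β * q‖ ^ 2 ≤ (‖α‖ * ‖p‖ + |β| * ‖q‖) ^ 2 :=
      pow_le_pow_left₀ (norm_nonneg _) h1 2
    have h3 : |β| ^ 2 = 1 - ‖α‖ ^ 2 := by rw [sq_abs, hβ]
    nlinarith [sq_nonneg (‖α‖ * ‖q‖ - |β| * ‖p‖)]
  · have e1 : ‖p‖ ^ 2 + ‖z + β * q‖ ^ 2 - (‖p‖ ^ 2 + ‖q‖ ^ 2) * (1 - ‖α‖ ^ 2)
        = 2 * (‖z‖ ^ 2 + β * r) := by
      rw [hw2, hzn, hβ]; ring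
    have e2 : 4 * ‖α‖ ^ 2 * ‖p‖ ^ 2 * ‖z + β * q‖ ^ 2
        = 4 * (‖z‖ ^ 2 * (‖z‖ ^ 2 + β ^ 2 * ‖q‖ ^ 2 + 2 * β * r)) := by
      rw [hw2, hzn]; ring
    rw [e1, e2]
    nlinarith [mul_le_mul_of_nonneg_left hcs (sq_nonneg β)]

lemma aux_E_corner (c : ℝ) (h0 : 0 ≤ c) (h1 : c ≤ 1) :
    ((0 : ℝ), 1 - c) ∈ Ecal c ∧ (1 - c, (0 : ℝ)) ∈ Ecal c := by
  constructor <;> simp [Ecal, h0, h1]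

lemma aux_forward {d : ℕ} (hd : 2 ≤ d) (a1 a2 φ : HSp d) (ha1 : ‖a1‖ = 1) (ha2 : ‖a2‖ = 1)
    (hφ : ‖φ‖ = 1) : ∃ t : ℝ, 0 ≤ t ∧ t ≤ 1 ∧ ∃ u ∈ Ecal (‖⟪a1, a2⟫‖ ^ 2),
      ‖⟪a1, φ⟫‖ ^ 2 = t * u.1 ∧ ‖⟪a2, φ⟫‖ ^ 2 = t * u.2 := by
  obtain ⟨e, β, he, hae, h, hβ⟩ := aux_frame hd a1 a2 ha1 ha2
  set α := ⟪a1, a2⟫ with hα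
  have hB := aux_bessel a1 e φ ha1 he hae hφ
  have hx2 : ⟪a2, φ⟫ = (starRingEnd ℂ α) * ⟪a1, φ⟫ + β * ⟪e, φ⟫ := by
    conv_lhs => rw [h]
    exact aux_inner_a2 _ _ _ _ _
  obtain ⟨s1, s2⟩ := aux_scalar α ⟪a1, φ⟫ ⟪e, φ⟫ β hβ
  rw [← hx2] at s1 s2
  set x1 := ‖⟪a1, φ⟫‖ ^ 2 with hx1
  set y := ‖⟪e, φ⟫‖ ^ 2 with hy
  set x2 := ‖⟪a2, φ⟫‖ ^ 2 with hx2'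
  have p1 : 0 ≤ x1 := by positivity
  have p2 : 0 ≤ x2 := by positivity
  have p3 : 0 ≤ y := by positivity
  have hc0 : 0 ≤ ‖α‖ ^ 2 := by positivity
  have hc1 : ‖α‖ ^ 2 ≤ 1 := by nlinarith [sq_nonneg β]
  rcases eq_or_lt_of_le (add_nonneg p1 p3) with ht | ht
  · refine ⟨0, le_rfl, zero_le_one, _, (aux_E_corner _ hc0 hc1).1, ?_, ?_⟩ <;> simp <;> linarith
  · have hne := ht.ne'
    refine ⟨x1 + y, ht.le, hB, (x1 / (x1 + y), x2 / (x1 + y)), ⟨⟨by positivity, ?_⟩,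
      ⟨by positivity, ?_⟩, ?_⟩, ?_, ?_⟩
    · show x1 / (x1 + y) ≤ 1
      rw [div_le_one ht]; linarith
    · show x2 / (x1 + y) ≤ 1
      rw [div_le_one ht]; linarith
    · show (x1 / (x1 + y) + x2 / (x1 + y) - (1 - ‖α‖ ^ 2)) ^ 2
        ≤ 4 * ‖α‖ ^ 2 * (x1 / (x1 + y)) * (x2 / (x1 + y))
      have e1 : (x1 / (x1 + y) + x2 / (x1 + y) - (1 - ‖α‖ ^ 2)) ^ 2
          = (x1 + x2 - (x1 + y) * (1 - ‖α‖ ^ 2)) ^ 2 / (x1 + y) ^ 2 := by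
        field_simp
      have e2 : 4 * ‖α‖ ^ 2 * (x1 / (x1 + y)) * (x2 / (x1 + y))
          = (4 * ‖α‖ ^ 2 * x1 * x2) / (x1 + y) ^ 2 := by
        field_simp
      rw [e1, e2]
      gcongr
    · show x1 = (x1 + y) * (x1 / (x1 + y))
      field_simp
    · show x2 = (x1 + y) * (x2 / (x1 + y))
      field_simp

lemma aux_scalar_rev (α : ℂ) (β : ℝ) (hβ : β ^ 2 = 1 - ‖α‖ ^ 2) (u : ℝ × ℝ)
    (hu : u ∈ Ecal (‖α‖ ^ 2)) : ∃ p q : ℂ, ‖p‖ ^ 2 + ‖q‖ ^ 2 = 1 ∧ ‖p‖ ^ 2 = u.1 ∧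
      ‖(starRingEnd ℂ α) * p + β * q‖ ^ 2 = u.2 := by
  obtain ⟨x1, x2⟩ := u
  obtain ⟨⟨h10, h11⟩, ⟨h20, h21⟩, hE⟩ := hu
  simp only at h10 h11 h20 h21 hE ⊢
  obtain ⟨ω, hω, hωα⟩ := RCLike.exists_norm_eq_mul_self (starRingEnd ℂ α)
  rw [RCLike.norm_conj] at hωα
  have hωα' : (‖α‖ : ℂ) = ω * (starRingEnd ℂ α) := hωα
  set g := ‖α‖ with hg
  set s := √x1
  set r := √(1 - x1)
  have hs : s ^ 2 = x1 := Real.sq_sqrt h10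
  have hr : r ^ 2 = 1 - x1 := Real.sq_sqrt (by linarith)
  set M := 2 * g * β * s * r with hM
  set y := x2 - g ^ 2 * x1 - (1 - g ^ 2) * (1 - x1) with hy
  have hM2 : M ^ 2 = 4 * g ^ 2 * (1 - g ^ 2) * x1 * (1 - x1) := by
    have e : M ^ 2 = 4 * g ^ 2 * β ^ 2 * s ^ 2 * r ^ 2 := by rw [hM]; ring
    rw [e, hβ, hs, hr]
  have hyM : y ^ 2 ≤ M ^ 2 := by
    rw [hM2, hy]
    nlinarith
  obtain ⟨k, hk, hyk⟩ : ∃ k : ℝ, k ^ 2 ≤ 1 ∧ y = M * k := by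
    by_cases hM0 : M = 0
    · refine ⟨0, by norm_num, ?_⟩
      rw [hM0] at hyM ⊢
      nlinarith
    · refine ⟨y / M, ?_, by field_simp⟩
      rw [div_pow, div_le_one (by positivity)]
      exact hyM
  set l := √(1 - k ^ 2)
  have hl : l ^ 2 = 1 - k ^ 2 := Real.sq_sqrt (by linarith)
  refine ⟨(s : ℂ) * ω, ⟨r * k, r * l⟩, ?_, ?_, ?_⟩
  · rw [norm_mul, hω, mul_one, ← Complex.normSq_eq_norm_sq, ← Complex.normSq_eq_norm_sq,
      Complex.normSq_apply, Complex.normSq_apply]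
    simp
    nlinarith
  · rw [norm_mul, hω, mul_one, Complex.norm_real, Real.norm_eq_abs, sq_abs, hs]
  · have : (starRingEnd ℂ α) * ((s : ℂ) * ω) = ((s * g : ℝ) : ℂ) := by
      push_cast
      rw [hωα']; ring
    rw [this, ← Complex.normSq_eq_norm_sq, Complex.normSq_apply]
    simp
    have e : (s * g + β * (r * k)) * (s * g + β * (r * k)) + β * (r * l) * (β * (r * l))
        = s ^ 2 * g ^ 2 + β ^ 2 * r ^ 2 * (k ^ 2 + l ^ 2) + M * k := by
      rw [hM]; ring
    rw [e, hs, hβ, hr, hl, ← hyk, hy]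
    ring

lemma aux_reverse {d : ℕ} (hd : 2 ≤ d) (a1 a2 : HSp d) (ha1 : ‖a1‖ = 1) (ha2 : ‖a2‖ = 1)
    (u : ℝ × ℝ) (hu : u ∈ Ecal (‖⟪a1, a2⟫‖ ^ 2)) : ∃ φ : HSp d, ‖φ‖ = 1 ∧
      ‖⟪a1, φ⟫‖ ^ 2 = u.1 ∧ ‖⟪a2, φ⟫‖ ^ 2 = u.2 := by
  obtain ⟨e, β, he, hae, h, hβ⟩ := aux_frame hd a1 a2 ha1 ha2
  obtain ⟨p, q, h1, hp, hq⟩ := aux_scalar_rev _ β hβ u hu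
  have hea : ⟪e, a1⟫ = 0 := inner_eq_zero_symm.mp hae
  have i1 : ⟪a1, p • a1 + q • e⟫ = p := by
    rw [inner_add_right, inner_smul_right, inner_smul_right, hae, inner_self_eq_norm_sq_to_K, ha1]
    simp
  have i2 : ⟪e, p • a1 + q • e⟫ = q := by
    rw [inner_add_right, inner_smul_right, inner_smul_right, hea, inner_self_eq_norm_sq_to_K, he]
    simp
  refine ⟨p • a1 + q • e, ?_, ?_, ?_⟩
  · have h2 := norm_add_sq_eq_norm_sq_add_norm_sq_of_inner_eq_zero (𝕜 := ℂ) (p • a1) (q • e)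
      (by rw [inner_smul_left, inner_smul_right, hae]; simp)
    rw [norm_smul p, norm_smul q, ha1, he] at h2
    have h3 : ‖p • a1 + q • e‖ ^ 2 = 1 := by
      rw [sq, h2]; linarith [sq ‖p‖, sq ‖q‖]
    exact (pow_eq_one_iff_of_nonneg (norm_nonneg _) two_ne_zero).mp h3
  · rw [i1, hp]
  · rw [← hq]
    conv_lhs => rw [h]
    rw [aux_inner_a2, i1, i2]

lemma aux_inner_tmul {m n : ℕ} (a a' : HSp m) (b b' : HSp n) :
    ⟪tmul a b, tmul a' b'⟫ = ⟪a, a'⟫ * ⟪b, b'⟫ := by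
  simp only [PiLp.inner_apply, tmul, RCLike.inner_apply, Finset.sum_mul_sum,
    Fintype.sum_prod_type, WithLp.equiv_symm_apply]
  refine Finset.sum_congr rfl fun i _ => Finset.sum_congr rfl fun j _ => ?_
  simp
  ring

lemma aux_trace {m n : ℕ} (ψ χ : HT m n) :
    (LinearMap.trace ℂ _ (rankOne ψ ∘ₗ rankOne χ)).re = ‖⟪χ, ψ⟫‖ ^ 2 := by
  have : rankOne ψ ∘ₗ rankOne χ = ((innerSL ℂ χ).toLinearMap).smulRight (⟪ψ, χ⟫ • ψ) := by
    ext1 x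
    simp [rankOne, inner_smul_right, smul_smul]
  rw [this, LinearMap.trace_smulRight]
  simp only [ContinuousLinearMap.coe_coe, innerSL_apply_apply, inner_smul_right]
  rw [← inner_conj_symm ψ χ, ← Complex.normSq_eq_conj_mul_self, Complex.ofReal_re,
    Complex.normSq_eq_norm_sq]

/-- The pair of expectation values as a real-linear map. -/
def auxL {m n : ℕ} (M N : HT m n →ₗ[ℂ] HT m n) : (HT m n →ₗ[ℂ] HT m n) →ₗ[ℝ] ℝ × ℝ where
  toFun σ := ((LinearMap.trace ℂ _ (σ ∘ₗ M)).re, (LinearMap.trace ℂ _ (σ ∘ₗ N)).re)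
  map_add' σ τ := by simp [LinearMap.add_comp]
  map_smul' r σ := by simp [LinearMap.smul_comp]

/-- For product unit vectors `ψj = aj ⊗ bj` with local fidelities
`c_A = |⟨a1,a2⟩|²`, `c_B = |⟨b1,b2⟩|²` and `P_j = |ψ_j⟩⟨ψ_j|`, the joint separable
numerical range `L_SEP(P1,P2) = {(Tr σP1, Tr σP2) : σ separable density}` equals the convex
hull of `S = {(x_{1,A}·x_{1,B}, x_{2,A}·x_{2,B}) : (x_{1,A},x_{2,A}) ∈ E_{c_A},
(x_{1,B},x_{2,B}) ∈ E_{c_B}}`. -/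
theorem stmt_13 {dA dB : ℕ} (hdA : 2 ≤ dA) (hdB : 2 ≤ dB)
    (a1 a2 : HSp dA) (b1 b2 : HSp dB)
    (ha1 : ‖a1‖ = 1) (ha2 : ‖a2‖ = 1) (hb1 : ‖b1‖ = 1) (hb2 : ‖b2‖ = 1)
    (cA cB : ℝ) (hcA : cA = ‖⟪a1, a2⟫‖ ^ 2) (hcB : cB = ‖⟪b1, b2⟫‖ ^ 2) :
    {x : ℝ × ℝ | ∃ σ : HT dA dB →ₗ[ℂ] HT dA dB, IsSepDensity σ ∧
        x = ((LinearMap.trace ℂ _ (σ ∘ₗ rankOne (tmul a1 b1))).re,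
             (LinearMap.trace ℂ _ (σ ∘ₗ rankOne (tmul a2 b2))).re)} =
      convexHull ℝ
        {x : ℝ × ℝ | ∃ u ∈ Ecal cA, ∃ v ∈ Ecal cB, x = (u.1 * v.1, u.2 * v.2)} := by
  set S := {x : ℝ × ℝ | ∃ u ∈ Ecal cA, ∃ v ∈ Ecal cB, x = (u.1 * v.1, u.2 * v.2)} with hS
  set G := {P : HT dA dB →ₗ[ℂ] HT dA dB |
    ∃ (a : HSp dA) (b : HSp dB), ‖a‖ = 1 ∧ ‖b‖ = 1 ∧ P = rankOne (tmul a b)} with hG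
  set L := auxL (rankOne (tmul a1 b1)) (rankOne (tmul a2 b2)) with hL
  have hLval : ∀ (a : HSp dA) (b : HSp dB), L (rankOne (tmul a b)) =
      (‖⟪a1, a⟫‖ ^ 2 * ‖⟪b1, b⟫‖ ^ 2, ‖⟪a2, a⟫‖ ^ 2 * ‖⟪b2, b⟫‖ ^ 2) := by
    intro a b
    show ((LinearMap.trace ℂ _ (rankOne (tmul a b) ∘ₗ rankOne (tmul a1 b1))).re,
      (LinearMap.trace ℂ _ (rankOne (tmul a b) ∘ₗ rankOne (tmul a2 b2))).re) = _
    rw [aux_trace, aux_trace, aux_inner_tmul, aux_inner_tmul, norm_mul, norm_mul, mul_pow, mul_pow]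
  have hLHS : {x : ℝ × ℝ | ∃ σ : HT dA dB →ₗ[ℂ] HT dA dB, IsSepDensity σ ∧
        x = ((LinearMap.trace ℂ _ (σ ∘ₗ rankOne (tmul a1 b1))).re,
             (LinearMap.trace ℂ _ (σ ∘ₗ rankOne (tmul a2 b2))).re)} = L '' convexHull ℝ G := by
    ext x
    constructor
    · rintro ⟨σ, hσ, rfl⟩
      exact ⟨σ, hσ, rfl⟩
    · rintro ⟨σ, hσ, rfl⟩
      exact ⟨σ, hσ, rfl⟩
  rw [hLHS, LinearMap.image_convexHull]
  have cs : ∀ {d : ℕ} (x y : HSp d), ‖x‖ = 1 → ‖y‖ = 1 → ‖⟪x, y⟫‖ ^ 2 ≤ 1 := by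
    intro d x y hx hy
    have := norm_inner_le_norm (𝕜 := ℂ) x y
    rw [hx, hy, mul_one] at this
    exact pow_le_one₀ (norm_nonneg _) this
  apply Set.Subset.antisymm
  · refine convexHull_min ?_ (convex_convexHull ℝ S)
    rintro _ ⟨_, ⟨a, b, ha, hb, rfl⟩, rfl⟩
    obtain ⟨s, hs0, hs1, u, hu, hu1, hu2⟩ := aux_forward hdA a1 a2 a ha1 ha2 ha
    obtain ⟨t, ht0, ht1, v, hv, hv1, hv2⟩ := aux_forward hdB b1 b2 b hb1 hb2 hb
    rw [← hcA] at hu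
    rw [← hcB] at hv
    have h0 : (0 : ℝ × ℝ) ∈ convexHull ℝ S := by
      apply subset_convexHull
      refine ⟨_, (aux_E_corner cA (by rw [hcA]; positivity) ?_).1, _,
        (aux_E_corner cB (by rw [hcB]; positivity) ?_).2, ?_⟩
      · rw [hcA]; exact cs _ _ ha1 ha2
      · rw [hcB]; exact cs _ _ hb1 hb2
      · ext <;> simp
    have huv : (u.1 * v.1, u.2 * v.2) ∈ convexHull ℝ S :=
      subset_convexHull ℝ S ⟨u, hu, v, hv, rfl⟩
    have := (convex_convexHull ℝ S).smul_mem_of_zero_mem h0 huv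
      (t := s * t) ⟨mul_nonneg hs0 ht0, mul_le_one₀ hs1 ht0 ht1⟩
    convert this using 1
    rw [hLval, hu1, hu2, hv1, hv2]
    ext <;> simp <;> ring
  · apply convexHull_mono
    rintro _ ⟨u, hu, v, hv, rfl⟩
    rw [hcA] at hu
    rw [hcB] at hv
    obtain ⟨a, ha, hu1, hu2⟩ := aux_reverse hdA a1 a2 ha1 ha2 u hu
    obtain ⟨b, hb, hv1, hv2⟩ := aux_reverse hdB b1 b2 hb1 hb2 v hv
    refine ⟨_, ⟨a, b, ha, hb, rfl⟩, ?_⟩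
    rw [hLval, hu1, hu2, hv1, hv2]
end
end

section
/- Let ψ1, ψ2 be unit vectors in a finite-dimensional complex inner product space H and φ1, φ2 unit vectors in a finite-dimensional complex inner product space H', such that |⟨ψ1, ψ2⟩| = |⟨φ1, φ2⟩|, span{ψ1, ψ2} ≠ H, and span{φ1, φ2} ≠ H'. Then the joint numerical ranges coincide: { (Tr(ρ·|ψ1⟩⟨ψ1|), Tr(ρ·|ψ2⟩⟨ψ2|)) : ρ a density operator on H } = { (Tr(ρ'·|φ1⟩⟨φ1|), Tr(ρ'·|φ2⟩⟨φ2|)) : ρ' a density operator on H' }. -/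
open scoped ComplexInnerProductSpace
noncomputable section

theorem aux_trace_s18 {H : Type*} [NormedAddCommGroup H] [InnerProductSpace ℂ H]
    [FiniteDimensional ℂ H] (ρ : H →ₗ[ℂ] H) (u : H) :
    LinearMap.trace ℂ H (ρ ∘ₗ rankOne u) = ⟪u, ρ u⟫ := by
  have h : ρ ∘ₗ rankOne u = ((innerSL ℂ u).toLinearMap).smulRight (ρ u) := by
    ext x; simp [rankOne]
  rw [h, LinearMap.trace_smulRight]; simp

theorem aux_perp {H : Type*} [NormedAddCommGroup H] [InnerProductSpace ℂ H]
    [FiniteDimensional ℂ H] (ψ1 ψ2 : H) (hV : Submodule.span ℂ {ψ1, ψ2} ≠ ⊤) :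
    ∃ e : H, ‖e‖ = 1 ∧ ⟪ψ1, e⟫ = 0 ∧ ⟪ψ2, e⟫ = 0 := by
  have h1 : (Submodule.span ℂ {ψ1, ψ2})ᗮ ≠ ⊥ := by
    intro h; exact hV ((Submodule.orthogonal_eq_bot_iff).1 h)
  obtain ⟨v, hv, hv0⟩ := Submodule.exists_mem_ne_zero_of_ne_bot h1
  have a1 : ⟪ψ1, v⟫ = 0 := hv ψ1 (Submodule.subset_span (by simp))
  have a2 : ⟪ψ2, v⟫ = 0 := hv ψ2 (Submodule.subset_span (by simp))
  refine ⟨((‖v‖⁻¹ : ℝ) : ℂ) • v, ?_, ?_, ?_⟩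
  · have : ‖v‖ ≠ 0 := by simpa using hv0
    simp [norm_smul, this]
  · rw [inner_smul_right, a1, mul_zero]
  · rw [inner_smul_right, a2, mul_zero]

theorem aux_gs {H : Type*} [NormedAddCommGroup H] [InnerProductSpace ℂ H]
    (ψ1 ψ2 e : H) (h1 : ‖ψ1‖ = 1) (h2 : ‖ψ2‖ = 1) (he : ‖e‖ = 1) (he1 : ⟪ψ1, e⟫ = 0) :
    ∃ f : H, ‖f‖ = 1 ∧ ⟪ψ1, f⟫ = 0 ∧
      ψ2 = ⟪ψ1, ψ2⟫ • ψ1 + ((Real.sqrt (1 - ‖⟪ψ1, ψ2⟫‖ ^ 2) : ℝ) : ℂ) • f := by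
  set a := ⟪ψ1, ψ2⟫ with ha
  set w := ψ2 - a • ψ1 with hw
  have h11 : ⟪ψ1, ψ1⟫ = 1 := by rw [inner_self_eq_norm_sq_to_K, h1]; simp
  have hw1 : ⟪ψ1, w⟫ = 0 := by
    rw [hw, inner_sub_right, inner_smul_right, h11, ← ha]; simp
  have hn : ‖w‖ ^ 2 = 1 - ‖a‖ ^ 2 := by
    have e1 : ψ2 = a • ψ1 + w := by simp [hw]
    have e2 : ‖a • ψ1 + w‖ * ‖a • ψ1 + w‖ = ‖a • ψ1‖ * ‖a • ψ1‖ + ‖w‖ * ‖w‖ :=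
      norm_add_sq_eq_norm_sq_add_norm_sq_of_inner_eq_zero _ _
        (by rw [inner_smul_left, hw1, mul_zero])
    rw [← e1, h2, norm_smul, h1] at e2
    nlinarith
  rw [← hn, Real.sqrt_sq (norm_nonneg _)]
  by_cases h0 : w = 0
  · refine ⟨e, he, he1, ?_⟩
    have : ψ2 = a • ψ1 := sub_eq_zero.1 h0
    rw [h0]; simpa using this
  · have h0' : ‖w‖ ≠ 0 := by simpa using h0
    refine ⟨((‖w‖⁻¹ : ℝ) : ℂ) • w, ?_, ?_, ?_⟩
    · simp [norm_smul, h0']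
    · rw [inner_smul_right, hw1, mul_zero]
    · rw [smul_smul, ← Complex.ofReal_mul, mul_inv_cancel₀ h0']
      simp [hw]

theorem aux_bound {H : Type*} [NormedAddCommGroup H] [InnerProductSpace ℂ H]
    [FiniteDimensional ℂ H] (ρ : H →ₗ[ℂ] H) (hρ : IsDensity ρ) (u f : H)
    (hu : ‖u‖ = 1) (hf : ‖f‖ = 1) (huf : ⟪u, f⟫ = 0) :
    (⟪u, ρ u⟫).re + (⟪f, ρ f⟫).re ≤ 1 := by
  classical
  obtain ⟨_, hpos, htr⟩ := hρ
  have hne : u ≠ f := by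
    rintro rfl
    rw [inner_self_eq_norm_sq_to_K, hu] at huf
    simp at huf
  have hfu : ⟪f, u⟫ = 0 := inner_eq_zero_symm.1 huf
  have ho : Orthonormal ℂ ((↑) : ({u, f} : Set H) → H) := by
    constructor
    · rintro ⟨x, rfl | rfl⟩ <;> assumption
    · rintro ⟨x, rfl | rfl⟩ ⟨y, rfl | rfl⟩ hxy <;> simp_all
  obtain ⟨s, b, hs, hb⟩ := ho.exists_orthonormalBasis_extension
  have hsum := LinearMap.trace_eq_sum_inner ρ b
  rw [htr] at hsum
  have hsum' := congrArg Complex.re hsum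
  rw [Complex.re_sum] at hsum'
  simp only [hb, Complex.one_re] at hsum'
  rw [hsum']
  have hus : u ∈ s := by exact_mod_cast hs (by simp)
  have hfs : f ∈ s := by exact_mod_cast hs (by simp)
  have := Finset.sum_le_sum_of_subset_of_nonneg
    (f := fun i : s => (⟪(i : H), ρ (i : H)⟫).re)
    (Finset.subset_univ {(⟨u, hus⟩ : s), (⟨f, hfs⟩ : s)}) (fun i _ _ => hpos _)
  rw [Finset.sum_pair (by simpa using hne)] at this
  exact this

theorem aux_dir {H H' : Type*}
    [NormedAddCommGroup H] [InnerProductSpace ℂ H] [FiniteDimensional ℂ H]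
    [NormedAddCommGroup H'] [InnerProductSpace ℂ H'] [FiniteDimensional ℂ H']
    (ψ1 ψ2 : H) (hψ1 : ‖ψ1‖ = 1) (hψ2 : ‖ψ2‖ = 1)
    (φ1 φ2 : H') (hφ1 : ‖φ1‖ = 1) (hφ2 : ‖φ2‖ = 1)
    (hfid : ‖⟪ψ1, ψ2⟫‖ = ‖⟪φ1, φ2⟫‖)
    (hV : Submodule.span ℂ {ψ1, ψ2} ≠ ⊤)
    (hV' : Submodule.span ℂ {φ1, φ2} ≠ ⊤) (ρ : H →ₗ[ℂ] H) (hρ : IsDensity ρ) :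
    ∃ ρ' : H' →ₗ[ℂ] H', IsDensity ρ' ∧
      (⟪ψ1, ρ ψ1⟫).re = (⟪φ1, ρ' φ1⟫).re ∧ (⟪ψ2, ρ ψ2⟫).re = (⟪φ2, ρ' φ2⟫).re := by
  obtain ⟨e, he, he1, he2⟩ := aux_perp ψ1 ψ2 hV
  obtain ⟨e', he', he1', he2'⟩ := aux_perp φ1 φ2 hV'
  obtain ⟨c, hc, hca⟩ : ∃ c : ℂ, ‖c‖ = 1 ∧ c * ⟪ψ1, ψ2⟫ = ⟪φ1, φ2⟫ := by
    by_cases h0 : ⟪ψ1, ψ2⟫ = 0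
    · refine ⟨1, by simp, ?_⟩
      rw [h0, norm_zero] at hfid
      rw [h0, norm_eq_zero.1 hfid.symm, mul_zero]
    · refine ⟨⟪φ1, φ2⟫ / ⟪ψ1, ψ2⟫, ?_, div_mul_cancel₀ _ h0⟩
      rw [norm_div, ← hfid, div_self (by simpa using h0)]
  have hin : ⟪ψ1, c • ψ2⟫ = ⟪φ1, φ2⟫ := by rw [inner_smul_right, hca]
  obtain ⟨f, hf, hf1, hfe⟩ := aux_gs ψ1 (c • ψ2) e hψ1 (by rw [norm_smul, hc, hψ2, one_mul]) he he1
  obtain ⟨g, hg, hg1, hge⟩ := aux_gs φ1 φ2 e' hφ1 hφ2 he' he1'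
  rw [hin] at hfe
  set a := ⟪φ1, φ2⟫
  set b : ℂ := ((Real.sqrt (1 - ‖a‖ ^ 2) : ℝ) : ℂ)
  have hg1' : ⟪g, φ1⟫ = 0 := inner_eq_zero_symm.1 hg1
  have n1 : ⟪φ1, φ1⟫ = 1 := by rw [inner_self_eq_norm_sq_to_K, hφ1]; simp
  have ng : ⟪g, g⟫ = 1 := by rw [inner_self_eq_norm_sq_to_K, hg]; simp
  have ne : ⟪e', e'⟫ = 1 := by rw [inner_self_eq_norm_sq_to_K, he']; simp
  let T : H' →ₗ[ℂ] H := ((innerSL ℂ φ1).toLinearMap).smulRight ψ1 +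
    ((innerSL ℂ g).toLinearMap).smulRight f
  let S : H →ₗ[ℂ] H' := ((innerSL ℂ ψ1).toLinearMap).smulRight φ1 +
    ((innerSL ℂ f).toLinearMap).smulRight g
  have Tap : ∀ x, T x = ⟪φ1, x⟫ • ψ1 + ⟪g, x⟫ • f := fun x => by simp [T]
  have Sap : ∀ x, S x = ⟪ψ1, x⟫ • φ1 + ⟪f, x⟫ • g := fun x => by simp [S]
  have hTS : ∀ x y, ⟪x, S y⟫ = ⟪T x, y⟫ := by
    intro x y
    rw [Tap, Sap]
    simp only [inner_add_left, inner_add_right, inner_smul_left, inner_smul_right,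
      inner_conj_symm]
    ring
  have hST : ∀ x y, ⟪S x, y⟫ = ⟪x, T y⟫ := by
    intro x y
    rw [← inner_conj_symm, hTS, inner_conj_symm]
  have T1 : T φ1 = ψ1 := by rw [Tap, n1, hg1']; simp
  have Tg : T g = f := by rw [Tap, ng, hg1]; simp
  have T2 : T φ2 = c • ψ2 := by rw [hge, map_add, map_smul, map_smul, T1, Tg, hfe]
  have hTT : ρ ∘ₗ T ∘ₗ S = ρ ∘ₗ rankOne ψ1 + ρ ∘ₗ rankOne f := by
    ext x
    simp [Sap, T1, Tg, rankOne]
  have htr : LinearMap.trace ℂ H' (S ∘ₗ ρ ∘ₗ T) = ⟪ψ1, ρ ψ1⟫ + ⟪f, ρ f⟫ := by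
    rw [LinearMap.trace_comp_comm', LinearMap.comp_assoc, hTT, map_add, aux_trace_s18, aux_trace_s18]
  have hreal : ∀ x, ((⟪x, ρ x⟫).re : ℂ) = ⟪x, ρ x⟫ := fun x => by
    rw [← Complex.conj_eq_iff_re, inner_conj_symm, hρ.1]
  have hbd := aux_bound ρ hρ ψ1 f hψ1 hf hf1
  set t : ℝ := 1 - ((⟪ψ1, ρ ψ1⟫).re + (⟪f, ρ f⟫).re) with ht
  have ht0 : 0 ≤ t := by linarith
  have rap : ∀ x, rankOne e' x = ⟪e', x⟫ • e' := fun x => by simp [rankOne]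
  refine ⟨S ∘ₗ ρ ∘ₗ T + (t : ℂ) • rankOne e', ⟨?_, ?_, ?_⟩, ?_, ?_⟩
  · intro x y
    simp only [LinearMap.add_apply, LinearMap.smul_apply, LinearMap.comp_apply, rap,
      inner_add_left, inner_add_right, inner_smul_left, inner_smul_right, hST, hTS,
      inner_conj_symm, Complex.conj_ofReal]
    rw [hρ.1]
    ring
  · intro x
    simp only [LinearMap.add_apply, LinearMap.smul_apply, LinearMap.comp_apply, rap,
      inner_add_right, inner_smul_right, hTS, Complex.add_re, Complex.re_ofReal_mul]
    have h1 := hρ.2.1 (T x)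
    have h2 : 0 ≤ (⟪e', x⟫ * ⟪x, e'⟫).re := by
      rw [← inner_conj_symm x e', Complex.mul_conj, Complex.ofReal_re]
      exact Complex.normSq_nonneg _
    positivity
  · have h3 : LinearMap.trace ℂ H' (rankOne e') = 1 := by
      have := aux_trace_s18 (LinearMap.id : H' →ₗ[ℂ] H') e'
      rw [LinearMap.id_comp] at this
      rw [this, LinearMap.id_apply, ne]
    rw [map_add, htr, map_smul, h3, ht]
    push_cast
    rw [hreal, hreal, smul_eq_mul]
    ring
  · simp only [LinearMap.add_apply, LinearMap.smul_apply, LinearMap.comp_apply, rap,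
      inner_add_right, inner_smul_right, hTS, T1, he1', mul_zero, add_zero]
  · simp only [LinearMap.add_apply, LinearMap.smul_apply, LinearMap.comp_apply, rap,
      inner_add_right, inner_smul_right, hTS, T2, he2', mul_zero, add_zero, map_smul,
      inner_smul_left]
    rw [← mul_assoc, Complex.mul_conj, Complex.normSq_eq_norm_sq, hc]
    simp

/-- For unit vectors `ψ1, ψ2` in `H` and `φ1, φ2` in `H'` with
`|⟨ψ1,ψ2⟩| = |⟨φ1,φ2⟩|`, `span{ψ1,ψ2} ≠ H` and `span{φ1,φ2} ≠ H'`, the joint numerical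
ranges of the corresponding pairs of rank-one projections coincide. -/
theorem stmt_18 {H H' : Type*}
    [NormedAddCommGroup H] [InnerProductSpace ℂ H] [FiniteDimensional ℂ H]
    [NormedAddCommGroup H'] [InnerProductSpace ℂ H'] [FiniteDimensional ℂ H']
    (ψ1 ψ2 : H) (hψ1 : ‖ψ1‖ = 1) (hψ2 : ‖ψ2‖ = 1)
    (φ1 φ2 : H') (hφ1 : ‖φ1‖ = 1) (hφ2 : ‖φ2‖ = 1)
    (hfid : ‖⟪ψ1, ψ2⟫‖ = ‖⟪φ1, φ2⟫‖)
    (hV : Submodule.span ℂ {ψ1, ψ2} ≠ ⊤)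
    (hV' : Submodule.span ℂ {φ1, φ2} ≠ ⊤) :
    {x : ℝ × ℝ | ∃ ρ : H →ₗ[ℂ] H, IsDensity ρ ∧
        x = ((LinearMap.trace ℂ H (ρ ∘ₗ rankOne ψ1)).re,
             (LinearMap.trace ℂ H (ρ ∘ₗ rankOne ψ2)).re)} =
    {x : ℝ × ℝ | ∃ ρ' : H' →ₗ[ℂ] H', IsDensity ρ' ∧
        x = ((LinearMap.trace ℂ H' (ρ' ∘ₗ rankOne φ1)).re,
             (LinearMap.trace ℂ H' (ρ' ∘ₗ rankOne φ2)).re)} := by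
  ext x
  simp only [Set.mem_setOf_eq, aux_trace_s18]
  constructor
  · rintro ⟨ρ, hρ, rfl⟩
    obtain ⟨ρ', h, h1, h2⟩ := aux_dir ψ1 ψ2 hψ1 hψ2 φ1 φ2 hφ1 hφ2 hfid hV hV' ρ hρ
    exact ⟨ρ', h, by rw [h1, h2]⟩
  · rintro ⟨ρ, hρ, rfl⟩
    obtain ⟨ρ', h, h1, h2⟩ := aux_dir φ1 φ2 hφ1 hφ2 ψ1 ψ2 hψ1 hψ2 hfid.symm hV' hV ρ hρ
    exact ⟨ρ', h, by rw [h1, h2]⟩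
end
end
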